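/- arXiv:1602.01634 — 2 statements merged into one kernel-verified Lean document; each statement's English description precedes it below -/
import Mathlib

section
/- For every choice of constants C1 > 0, C2 > 0, B > 0 and every β with 2/3 < β ≤ 1, there exists ε0 > 0 (depending only on C1, C2, B, β) such that the following holds: if α ∈ (1 − ε0, 1) and E ⊆ [0,1] is a closed set supporting a Borel probability measure μ satisfying (i) μ([x, x+ε]) ≤ C1·ε^α for every x ∈ ℝ and every 0 < ε ≤ 1, and (ii) |μ̂(k)| ≤ C2·(1−α)^{−B}·|k|^{−β/2} for every k ∈ ℤ \ {0}, then E contains a non-trivial three-term arithmetic progression, i.e. there exist x ∈ ℝ and d ≠ 0 with x, x+d, x+2d ∈ E. -/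
open MeasureTheory Filter Set

/-- The Fourier–Stieltjes transform of a finite Borel measure on ℝ:
`μ̂(ξ) = ∫ e^{−2πiξx} dμ(x)`. -/
noncomputable def ftransform (μ : MeasureTheory.Measure ℝ) (ξ : ℝ) : ℂ :=
  ∫ x : ℝ, Complex.exp ((-2) * (Real.pi : ℂ) * Complex.I * (ξ : ℂ) * (x : ℂ)) ∂μ

/-- The character `x ↦ e^{2πikx}` of `ℝ/ℤ`. -/
noncomputable def echar (k : ℤ) (x : ℝ) : ℂ :=
  Complex.exp (2 * Real.pi * Complex.I * k * x)

/-- The trigonometric polynomial with frequencies in `S` and coefficients `a`. -/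
noncomputable def trigPoly (S : Finset ℤ) (a : ℤ → ℂ) (x : ℝ) : ℂ :=
  ∑ k ∈ S, a k * echar k x

@[fun_prop]
lemma continuous_echar (k : ℤ) : Continuous (echar k) := by
  unfold echar; fun_prop

@[fun_prop]
lemma continuous_trigPoly (S : Finset ℤ) (a : ℤ → ℂ) : Continuous (trigPoly S a) := by
  unfold trigPoly; fun_prop

lemma echar_zero (x : ℝ) : echar 0 x = 1 := by simp [echar]

lemma echar_add_left (k l : ℤ) (x : ℝ) : echar (k + l) x = echar k x * echar l x := by
  simp only [echar, ← Complex.exp_add]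
  congr 1; push_cast; ring

lemma echar_add_right (k : ℤ) (x y : ℝ) : echar k (x + y) = echar k x * echar k y := by
  simp only [echar, ← Complex.exp_add]
  congr 1; push_cast; ring

lemma echar_two_mul_right (k : ℤ) (x : ℝ) : echar k (2 * x) = echar (2 * k) x := by
  simp only [echar]
  congr 1; push_cast; ring

lemma integral_echar (k : ℤ) :
    ∫ x in (0 : ℝ)..1, echar k x = if k = 0 then 1 else 0 := by
  split_ifs with hk
  · simp [hk, echar_zero]
  · have hc : 2 * (Real.pi : ℂ) * Complex.I * k ≠ 0 := by
      simp [hk, Real.pi_ne_zero]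
    have h := integral_exp_mul_complex (a := 0) (b := 1) hc
    simp only [echar]
    rw [h]
    have : Complex.exp (2 * Real.pi * Complex.I * k * ((1 : ℝ) : ℂ)) = 1 := by
      rw [Complex.exp_eq_one_iff]; exact ⟨k, by push_cast; ring⟩
    rw [this]; simp

/-- The trilinear form counting three-term progressions, twisted by a character of the torus,
expressed through Fourier coefficients. -/
lemma integral_trigPoly_progression (S : Finset ℤ) (a b c : ℤ → ℂ) (i j : ℤ) :
    ∫ d in (0 : ℝ)..1, ∫ x in (0 : ℝ)..1,
      trigPoly S a x * trigPoly S b (x + d) * trigPoly S c (x + 2 * d) *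
        (echar i x * echar j d) =
    ∑ m ∈ S, ∑ k ∈ S, ∑ l ∈ S,
      if k = m + j - i ∧ l = -2 * m - j then a k * b l * c m else 0 := by
  have hpt : ∀ d x : ℝ, trigPoly S a x * trigPoly S b (x + d) * trigPoly S c (x + 2 * d) *
        (echar i x * echar j d) = ∑ m ∈ S, ∑ k ∈ S, ∑ l ∈ S,
          (a k * b l * c m * echar (l + 2 * m + j) d) * echar (k + l + m + i) x := by
    intro d x
    rw [show trigPoly S a x * trigPoly S b (x + d) * trigPoly S c (x + 2 * d) *
      (echar i x * echar j d) = trigPoly S c (x + 2 * d) * (trigPoly S a x *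
        (trigPoly S b (x + d) * (echar i x * echar j d))) by ring]
    rw [trigPoly, Finset.sum_mul]
    refine Finset.sum_congr rfl fun m _ => ?_
    rw [trigPoly, Finset.sum_mul, Finset.mul_sum]
    refine Finset.sum_congr rfl fun k _ => ?_
    rw [trigPoly, Finset.sum_mul, Finset.mul_sum, Finset.mul_sum]
    refine Finset.sum_congr rfl fun l _ => ?_
    simp only [echar_add_left, echar_add_right, echar_two_mul_right]
    ring
  have hx : ∀ d : ℝ, ∫ x in (0 : ℝ)..1, trigPoly S a x * trigPoly S b (x + d) *
      trigPoly S c (x + 2 * d) * (echar i x * echar j d) = ∑ m ∈ S, ∑ k ∈ S, ∑ l ∈ S,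
        (a k * b l * c m * (if k + l + m + i = 0 then 1 else 0)) * echar (l + 2 * m + j) d := by
    intro d
    simp only [hpt]
    rw [intervalIntegral.integral_finsetSum
      (fun _ _ => (by fun_prop : Continuous _).intervalIntegrable _ _)]
    refine Finset.sum_congr rfl fun m _ => ?_
    rw [intervalIntegral.integral_finsetSum
      (fun _ _ => (by fun_prop : Continuous _).intervalIntegrable _ _)]
    refine Finset.sum_congr rfl fun k _ => ?_
    rw [intervalIntegral.integral_finsetSum
      (fun _ _ => (by fun_prop : Continuous _).intervalIntegrable _ _)]
    refine Finset.sum_congr rfl fun l _ => ?_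
    rw [intervalIntegral.integral_const_mul, integral_echar]
    ring
  simp only [hx]
  rw [intervalIntegral.integral_finsetSum
    (fun _ _ => (by fun_prop : Continuous _).intervalIntegrable _ _)]
  refine Finset.sum_congr rfl fun m _ => ?_
  rw [intervalIntegral.integral_finsetSum
    (fun _ _ => (by fun_prop : Continuous _).intervalIntegrable _ _)]
  refine Finset.sum_congr rfl fun k _ => ?_
  rw [intervalIntegral.integral_finsetSum
    (fun _ _ => (by fun_prop : Continuous _).intervalIntegrable _ _)]
  refine Finset.sum_congr rfl fun l _ => ?_
  rw [intervalIntegral.integral_const_mul, integral_echar]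
  by_cases h : k = m + j - i ∧ l = -2 * m - j
  · rw [if_pos h, if_pos (by omega), if_pos (by omega)]; ring
  · rw [if_neg h]
    by_cases h2 : l + 2 * m + j = 0
    · rw [if_neg (by omega)]; ring
    · rw [if_neg h2]; ring

lemma norm_integral_progression_le {v : ℤ → ℝ} (hv0 : ∀ k, 0 ≤ v k)
    (hv : Summable fun k => v k ^ 3) {A B C : ℝ} {a b c : ℤ → ℂ}
    (hA : 0 ≤ A) (hB : 0 ≤ B) (hC : 0 ≤ C)
    (ha : ∀ k, ‖a k‖ ≤ A * v k) (hb : ∀ k, ‖b k‖ ≤ B * v k) (hc : ∀ k, ‖c k‖ ≤ C * v k)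
    (S : Finset ℤ) (i j : ℤ) :
    ‖∫ d in (0 : ℝ)..1, ∫ x in (0 : ℝ)..1,
      trigPoly S a x * trigPoly S b (x + d) * trigPoly S c (x + 2 * d) *
        (echar i x * echar j d)‖ ≤ A * B * C * ∑' k, v k ^ 3 := by
  rw [integral_trigPoly_progression]
  have hv3 : ∀ k, 0 ≤ v k ^ 3 := fun k => pow_nonneg (hv0 k) 3
  have hinj1 : Function.Injective fun m : ℤ => m + j - i := fun x y h => by
    simp only at h; omega
  have hinj2 : Function.Injective fun m : ℤ => -2 * m - j := fun x y h => by
    simp only at h; omega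
  have key : ∀ g : ℤ → ℤ, Function.Injective g →
      ∑ m ∈ S, v (g m) ^ 3 ≤ ∑' k, v k ^ 3 := fun g hg =>
    ((hv.comp_injective hg).sum_le_tsum S fun m _ => hv3 (g m)).trans
      (tsum_comp_le_tsum_of_inj hv hv3 hg)
  have hterm : ∀ m ∈ S, ‖∑ k ∈ S, ∑ l ∈ S,
      if k = m + j - i ∧ l = -2 * m - j then a k * b l * c m else 0‖ ≤
      A * B * C * ((v (m + j - i) ^ 3 + v (-2 * m - j) ^ 3 + v m ^ 3) / 3) := by
    intro m _
    have hr : 0 ≤ A * B * C * ((v (m + j - i) ^ 3 + v (-2 * m - j) ^ 3 + v m ^ 3) / 3) := by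
      have := hv3 (m + j - i); have := hv3 (-2 * m - j); have := hv3 m; positivity
    simp only [ite_and, Finset.sum_ite_irrel, Finset.sum_ite_eq', Finset.sum_const_zero]
    split_ifs
    · rw [norm_mul, norm_mul]
      have h1 := hv0 (m + j - i); have h2 := hv0 (-2 * m - j); have h3 := hv0 m
      calc _ ≤ (A * v (m + j - i)) * (B * v (-2 * m - j)) * (C * v m) := by
            gcongr
            · exact ha _
            · exact hb _
            · exact hc _
        _ = A * B * C * (v (m + j - i) * v (-2 * m - j) * v m) := by ring
        _ ≤ _ := by
            gcongr
            generalize v (m + j - i) = x at *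
            generalize v (-2 * m - j) = y at *
            generalize v m = z at *
            nlinarith [mul_nonneg (add_nonneg (add_nonneg h1 h2) h3)
              (add_nonneg (add_nonneg (sq_nonneg (x - y)) (sq_nonneg (y - z)))
                (sq_nonneg (x - z)))]
    · simpa using hr
    · simpa using hr
  refine (norm_sum_le _ _).trans ((Finset.sum_le_sum hterm).trans ?_)
  rw [← Finset.mul_sum, ← Finset.sum_div, Finset.sum_add_distrib, Finset.sum_add_distrib]
  gcongr
  have := key _ hinj1; have := key _ hinj2; have := key id Function.injective_id
  simp only [id] at this
  linarith

/-- **Roth's theorem** for bounded weights on an initial segment of `ℕ`. -/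
lemma exists_roth_weight_bound {M : ℝ} (hM : 0 < M) :
    ∃ m : ℕ, 0 < m ∧ ∀ b : ℕ → ℝ, (∀ i, 0 ≤ b i) → (∀ i, b i ≤ M) →
      (∑ i ∈ Finset.range m, (b i - 1 / 2)) / (m * M) - 1 / (8 * M) ≤
        8 * ∑ i ∈ Finset.range m, ∑ s ∈ Finset.Icc 1 m, b i * b (i + s) * b (i + 2 * s) := by
  refine ⟨cornersTheoremBound (1 / (8 * M) / 3) + 1, Nat.succ_pos _, fun b hb0 hbM => ?_⟩
  set m := cornersTheoremBound (1 / (8 * M) / 3) + 1 with hm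
  have hmpos : (0 : ℝ) < m := by rw [hm]; positivity
  have hterm : ∀ i s, 0 ≤ b i * b (i + s) * b (i + 2 * s) := fun i s =>
    mul_nonneg (mul_nonneg (hb0 _) (hb0 _)) (hb0 _)
  set A := (Finset.range m).filter fun i => 1 / 2 ≤ b i with hA
  by_cases hcard : 1 / (8 * M) * m ≤ (A.card : ℝ)
  · have hroth := roth_3ap_theorem_nat (1 / (8 * M)) (by positivity)
      (by omega : _ ≤ m) A (Finset.filter_subset _ _) hcard
    rw [threeAPFree_iff_eq_right] at hroth
    push Not at hroth
    obtain ⟨p, hp, q, hq, r, hr, hpqr, hne⟩ := hroth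
    wlog hlt : p < r generalizing p r
    · exact this r hr p hp (by omega) hne.symm (by omega)
    simp only [hA, Finset.coe_filter, Finset.mem_range, mem_ofPred_eq] at hp hq hr
    have hp0 := hb0 p
    have hq0 := hb0 q
    have hone : 1 / 8 ≤ ∑ i ∈ Finset.range m, ∑ s ∈ Finset.Icc 1 m,
        b i * b (i + s) * b (i + 2 * s) := by
      calc (1 / 8 : ℝ) = 1 / 2 * (1 / 2) * (1 / 2) := by norm_num
        _ ≤ b p * b q * b r := by gcongr; exacts [hp.2, hq.2, hr.2]
        _ = b p * b (p + (q - p)) * b (p + 2 * (q - p)) := by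
            congr 3 <;> omega
        _ ≤ ∑ s ∈ Finset.Icc 1 m, b p * b (p + s) * b (p + 2 * s) :=
            Finset.single_le_sum (f := fun s => b p * b (p + s) * b (p + 2 * s))
              (fun s _ => hterm p s) (Finset.mem_Icc.2 ⟨by omega, by omega⟩)
        _ ≤ _ := Finset.single_le_sum
              (f := fun i => ∑ s ∈ Finset.Icc 1 m, b i * b (i + s) * b (i + 2 * s))
              (fun i _ => Finset.sum_nonneg fun s _ => hterm i s) (Finset.mem_range.2 hp.1)
    have hsum : ∑ i ∈ Finset.range m, (b i - 1 / 2) ≤ m * M := by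
      calc _ ≤ ∑ i ∈ Finset.range m, M := Finset.sum_le_sum fun i _ => by linarith [hbM i]
        _ = m * M := by simp
    have h1 : (∑ i ∈ Finset.range m, (b i - 1 / 2)) / (m * M) ≤ 1 :=
      div_le_one_of_le₀ hsum (by positivity)
    have : 0 < 1 / (8 * M) := by positivity
    linarith
  · have hsum : ∑ i ∈ Finset.range m, (b i - 1 / 2) ≤ A.card * M := by
      calc _ ≤ ∑ i ∈ Finset.range m, (if 1 / 2 ≤ b i then M else 0) :=
            Finset.sum_le_sum fun i _ => by
              split_ifs with h
              · linarith [hbM i]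
              · linarith
        _ = A.card * M := by rw [← Finset.sum_filter]; simp [hA]
    have h1 : (∑ i ∈ Finset.range m, (b i - 1 / 2)) / (m * M) ≤ 1 / (8 * M) := by
      rw [div_le_iff₀ (by positivity)]
      push Not at hcard
      calc _ ≤ A.card * M := hsum
        _ ≤ (1 / (8 * M) * m) * M := by gcongr
        _ = _ := by ring
    have : 0 ≤ ∑ i ∈ Finset.range m, ∑ s ∈ Finset.Icc 1 m, b i * b (i + s) * b (i + 2 * s) :=
      Finset.sum_nonneg fun i _ => Finset.sum_nonneg fun s _ => hterm i s
    linarith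

lemma intervalIntegral_comp_add_right_of_periodic {F : ℝ → ℝ} (hF : Function.Periodic F 1)
    (t : ℝ) : ∫ x in (0 : ℝ)..1, F (x + t) = ∫ x in (0 : ℝ)..1, F x := by
  rw [intervalIntegral.integral_comp_add_right]
  have := hF.intervalIntegral_add_eq t 0
  rw [zero_add] at this ⊢
  rw [← this, add_comm]

@[fun_prop]
lemma continuous_integral_progression {a b c : ℝ → ℝ} (ha : Continuous a) (hb : Continuous b)
    (hc : Continuous c) :
    Continuous fun d : ℝ => ∫ x in (0 : ℝ)..1, a x * b (x + d) * c (x + 2 * d) :=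
  intervalIntegral.continuous_parametric_intervalIntegral_of_continuous' (by fun_prop) 0 1

/-- A Varnavides-type averaging of Roth's theorem: a bounded function on the circle of large mean
has many progressions whose common difference is comparable to a given `τ`. -/
lemma exists_varnavides_bound {M : ℝ} (hM : 0 < M) :
    ∃ m : ℕ, 0 < m ∧ ∀ τ : ℝ, 0 < τ → 2 * τ * m ≤ 1 →
      ∀ v : ℝ → ℝ, Continuous v → (∀ d, 0 ≤ v d) → (∀ d, τ ≤ d → d ≤ 2 * τ * m → v d = 1) →
      ∀ a : ℝ → ℝ, Continuous a → Function.Periodic a 1 → (∀ x, 0 ≤ a x) → (∀ x, a x ≤ M) →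
        3 / 4 ≤ ∫ x in (0 : ℝ)..1, a x →
        τ / (64 * M * m ^ 2) ≤
          ∫ d in (0 : ℝ)..1, v d * ∫ x in (0 : ℝ)..1, a x * a (x + d) * a (x + 2 * d) := by
  obtain ⟨m, hm, hroth⟩ := exists_roth_weight_bound hM
  refine ⟨m, hm, fun τ hτ hτm v hv hv0 hv1 a ha hper ha0 haM hmean => ?_⟩
  have hmpos : (0 : ℝ) < m := by exact_mod_cast hm
  have hm1 : (1 : ℝ) ≤ m := by exact_mod_cast hm
  set Ψ : ℝ → ℝ := fun d => ∫ x in (0 : ℝ)..1, a x * a (x + d) * a (x + 2 * d) with hΨ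
  have hΨc : Continuous Ψ := continuous_integral_progression ha ha ha
  have hΨ0 : ∀ d, 0 ≤ Ψ d := fun d => intervalIntegral.integral_nonneg zero_le_one fun x _ =>
    mul_nonneg (mul_nonneg (ha0 _) (ha0 _)) (ha0 _)
  have hfix : ∀ t : ℝ, 1 / (64 * M) ≤ m * ∑ s ∈ Finset.Icc 1 m, Ψ (s * t) := by
    intro t
    have hshift : ∀ i s : ℕ, ∫ x in (0 : ℝ)..1, a (x + (i : ℕ) * t) * a (x + (i + s : ℕ) * t) *
        a (x + (i + 2 * s : ℕ) * t) = Ψ (s * t) := by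
      intro i s
      rw [hΨ]
      simp only
      rw [← intervalIntegral_comp_add_right_of_periodic
        (F := fun x => a x * a (x + s * t) * a (x + 2 * (s * t))) _ (i * t)]
      · refine intervalIntegral.integral_congr fun x _ => ?_
        have e₁ : x + (i + s : ℕ) * t = x + i * t + s * t := by push_cast; ring
        have e₂ : x + (i + 2 * s : ℕ) * t = x + i * t + 2 * (s * t) := by push_cast; ring
        simp only [e₁, e₂]
      · intro x
        simp only
        rw [hper, add_right_comm, hper, add_right_comm, hper]
    have hmono : ∫ x in (0 : ℝ)..1, ((∑ i ∈ Finset.range m, (a (x + i * t) - 1 / 2)) / (m * M)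
          - 1 / (8 * M)) ≤
        ∫ x in (0 : ℝ)..1, 8 * ∑ i ∈ Finset.range m, ∑ s ∈ Finset.Icc 1 m,
          a (x + (i : ℕ) * t) * a (x + (i + s : ℕ) * t) * a (x + (i + 2 * s : ℕ) * t) :=
      intervalIntegral.integral_mono_on zero_le_one
        ((by fun_prop : Continuous _).intervalIntegrable _ _)
        ((by fun_prop : Continuous _).intervalIntegrable _ _)
        fun x _ => hroth (fun i => a (x + i * t)) (fun _ => ha0 _) (fun _ => haM _)
    have hleft : ∫ x in (0 : ℝ)..1, ((∑ i ∈ Finset.range m, (a (x + i * t) - 1 / 2)) / (m * M)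
          - 1 / (8 * M)) = ((∫ x in (0 : ℝ)..1, a x) - 1 / 2) / M - 1 / (8 * M) := by
      rw [intervalIntegral.integral_sub
        ((by fun_prop : Continuous _).intervalIntegrable _ _)
        ((by fun_prop : Continuous _).intervalIntegrable _ _), intervalIntegral.integral_div,
        intervalIntegral.integral_finsetSum
        (fun _ _ => (by fun_prop : Continuous _).intervalIntegrable _ _)]
      have : ∀ i ∈ Finset.range m, ∫ x in (0 : ℝ)..1, (a (x + i * t) - 1 / 2) =
          (∫ x in (0 : ℝ)..1, a x) - 1 / 2 := by
        intro i _
        rw [intervalIntegral.integral_sub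
          ((by fun_prop : Continuous _).intervalIntegrable _ _)
          ((by fun_prop : Continuous _).intervalIntegrable _ _),
          intervalIntegral_comp_add_right_of_periodic hper]
        simp
      rw [Finset.sum_congr rfl this]
      simp only [Finset.sum_const, Finset.card_range, nsmul_eq_mul,
        intervalIntegral.integral_const, sub_zero, smul_eq_mul, one_mul]
      field_simp
    have hright : ∫ x in (0 : ℝ)..1, 8 * ∑ i ∈ Finset.range m, ∑ s ∈ Finset.Icc 1 m,
          a (x + (i : ℕ) * t) * a (x + (i + s : ℕ) * t) * a (x + (i + 2 * s : ℕ) * t) =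
        8 * (m * ∑ s ∈ Finset.Icc 1 m, Ψ (s * t)) := by
      rw [intervalIntegral.integral_const_mul, intervalIntegral.integral_finsetSum
        (fun _ _ => (by fun_prop : Continuous _).intervalIntegrable _ _)]
      congr 1
      rw [← nsmul_eq_mul]
      conv_rhs => rw [← Finset.card_range m, ← Finset.sum_const]
      refine Finset.sum_congr (by simp) fun i _ => ?_
      rw [intervalIntegral.integral_finsetSum
        (fun _ _ => (by fun_prop : Continuous _).intervalIntegrable _ _)]
      simp only [hshift, Finset.card_range]
    rw [hleft, hright] at hmono
    have h1 : (1 / 4) / M ≤ ((∫ x in (0 : ℝ)..1, a x) - 1 / 2) / M := by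
      gcongr; linarith
    have h2 : (1 / 4) / M - 1 / (8 * M) = 8 * (1 / (64 * M)) := by field_simp; norm_num
    linarith
  have hvΨ : Continuous fun d => v d * Ψ d := hv.mul hΨc
  have hvΨ0 : ∀ d, 0 ≤ v d * Ψ d := fun d => mul_nonneg (hv0 d) (hΨ0 d)
  set I := ∫ d in (0 : ℝ)..1, v d * Ψ d with hI
  have hscale : ∀ s ∈ Finset.Icc 1 m, ∫ t in τ..(2 * τ), Ψ (s * t) ≤ I := by
    intro s hs
    obtain ⟨hs1, hsm⟩ := Finset.mem_Icc.1 hs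
    have hs1' : (1 : ℝ) ≤ s := by exact_mod_cast hs1
    have hsm' : (s : ℝ) ≤ m := by exact_mod_cast hsm
    have hspos : (0 : ℝ) < s := by linarith
    have hcongr : ∫ t in τ..(2 * τ), Ψ (s * t) = ∫ t in τ..(2 * τ), v (s * t) * Ψ (s * t) := by
      refine intervalIntegral.integral_congr fun t ht => ?_
      rw [uIcc_of_le (by linarith)] at ht
      rw [hv1 _ (by nlinarith [ht.1]) (by nlinarith [ht.1, ht.2]), one_mul]
    rw [hcongr, intervalIntegral.integral_comp_mul_left (fun d => v d * Ψ d) hspos.ne',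
      smul_eq_mul]
    have hle : ∫ d in (s * τ)..(s * (2 * τ)), v d * Ψ d ≤ I :=
      intervalIntegral.integral_mono_interval (by positivity) (by nlinarith) (by nlinarith)
        (Eventually.of_forall hvΨ0) (hvΨ.intervalIntegrable _ _)
    have hnn : 0 ≤ ∫ d in (s * τ)..(s * (2 * τ)), v d * Ψ d :=
      intervalIntegral.integral_nonneg (by nlinarith) fun d _ => hvΨ0 d
    calc _ ≤ 1 * ∫ d in (s * τ)..(s * (2 * τ)), v d * Ψ d := by
          gcongr; exact inv_le_one_of_one_le₀ hs1'
      _ ≤ I := by rw [one_mul]; exact hle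
  have hlow : τ * (1 / (64 * M)) ≤ ∫ t in τ..(2 * τ), m * ∑ s ∈ Finset.Icc 1 m, Ψ (s * t) := by
    calc τ * (1 / (64 * M)) = ∫ t in τ..(2 * τ), 1 / (64 * M) := by
          rw [intervalIntegral.integral_const, smul_eq_mul]; ring
      _ ≤ _ := intervalIntegral.integral_mono_on (by linarith)
          ((by fun_prop : Continuous _).intervalIntegrable _ _)
          ((by fun_prop : Continuous _).intervalIntegrable _ _) fun t _ => hfix t
  rw [intervalIntegral.integral_const_mul, intervalIntegral.integral_finsetSum
    (fun _ _ => (by fun_prop : Continuous _).intervalIntegrable _ _)] at hlow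
  have hup := Finset.sum_le_sum hscale
  rw [Finset.sum_const, Nat.card_Icc, nsmul_eq_mul, Nat.add_sub_cancel] at hup
  rw [div_le_iff₀ (by positivity)]
  have : τ * (1 / (64 * M)) ≤ m * (m * I) := hlow.trans (by gcongr)
  rw [mul_one_div, div_le_iff₀ (by positivity)] at this
  linarith

/-- The nonnegative trigonometric polynomial proportional to `cos(πx)^{2n}`, normalized to have
mean one. -/
noncomputable def cosKernel (n : ℕ) (x : ℝ) : ℝ :=
  4 ^ n / n.centralBinom * Real.cos (Real.pi * x) ^ (2 * n)

/-- The Fourier coefficients of `cosKernel`. -/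
noncomputable def cosCoeff (n : ℕ) (k : ℤ) : ℝ :=
  (2 * n).choose (n + k.natAbs) / n.centralBinom

lemma centralBinom_cast_pos (n : ℕ) : (0 : ℝ) < n.centralBinom := by
  exact_mod_cast n.centralBinom_pos

lemma cosCoeff_nonneg (n : ℕ) (k : ℤ) : 0 ≤ cosCoeff n k := by unfold cosCoeff; positivity

lemma cosCoeff_le_one (n : ℕ) (k : ℤ) : cosCoeff n k ≤ 1 := by
  unfold cosCoeff
  exact div_le_one_of_le₀ (by exact_mod_cast Nat.choose_le_centralBinom _ _)
    (centralBinom_cast_pos n).le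

lemma cosCoeff_zero (n : ℕ) : cosCoeff n 0 = 1 := by
  have := (centralBinom_cast_pos n).ne'
  simp only [cosCoeff, Int.natAbs_zero, add_zero, ← Nat.centralBinom_eq_two_mul_choose]
  exact div_self this

lemma cosCoeff_eq_zero {n : ℕ} {k : ℤ} (h : n < k.natAbs) : cosCoeff n k = 0 := by
  simp [cosCoeff, Nat.choose_eq_zero_of_lt (by omega : 2 * n < n + k.natAbs)]

lemma one_sub_choose_div_centralBinom_le {n : ℕ} (hn : 0 < n) (k : ℕ) :
    1 - ((2 * n).choose (n + k) : ℝ) / n.centralBinom ≤ (k : ℝ) ^ 2 / n := by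
  have hc := centralBinom_cast_pos n
  have hn' : (0 : ℝ) < n := by exact_mod_cast hn
  induction k with
  | zero => simp [← Nat.centralBinom_eq_two_mul_choose, div_self hc.ne']
  | succ k ih =>
    have hq1 : ((2 * n).choose (n + k) : ℝ) / n.centralBinom ≤ 1 :=
      div_le_one_of_le₀ (by exact_mod_cast Nat.choose_le_centralBinom _ _) hc.le
    have hq0 : 0 ≤ ((2 * n).choose (n + k) : ℝ) / n.centralBinom := by positivity
    rcases le_or_gt n k with hk | hk
    · have h1 : (1 : ℝ) ≤ ((k + 1 : ℕ) : ℝ) ^ 2 / n := by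
        rw [le_div_iff₀ hn', one_mul]
        exact_mod_cast (by nlinarith : n ≤ (k + 1) ^ 2)
      have h2 : 0 ≤ ((2 * n).choose (n + (k + 1)) : ℝ) / n.centralBinom := by positivity
      linarith
    · have hrec := Nat.choose_succ_right_eq (2 * n) (n + k)
      have hrec' : ((2 * n).choose (n + (k + 1)) : ℝ) * (n + k + 1) =
          (2 * n).choose (n + k) * (n - k) := by
        have : ((2 * n - (n + k) : ℕ) : ℝ) = n - k := by
          rw [Nat.cast_sub (by omega)]; push_cast; ring
        rw [← this]
        exact_mod_cast hrec
      set q := ((2 * n).choose (n + k) : ℝ) / n.centralBinom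
      have hq' : ((2 * n).choose (n + (k + 1)) : ℝ) / n.centralBinom =
          q - q * ((2 * k + 1) / (n + k + 1)) := by
        simp only [q]
        field_simp
        linarith
      rw [hq']
      have h3 : q * ((2 * k + 1) / (n + k + 1)) ≤ 1 * ((2 * k + 1) / n) := by
        gcongr
        linarith [(Nat.cast_nonneg k : (0 : ℝ) ≤ k)]
      have h4 : ((k + 1 : ℕ) : ℝ) ^ 2 / n = (k : ℝ) ^ 2 / n + 1 * ((2 * k + 1) / n) := by
        push_cast; ring
      linarith

lemma one_sub_cosCoeff_le {n : ℕ} (hn : 0 < n) (k : ℤ) :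
    1 - cosCoeff n k ≤ (k : ℝ) ^ 2 / n := by
  have := one_sub_choose_div_centralBinom_le hn k.natAbs
  rwa [Nat.cast_natAbs, Int.cast_abs, sq_abs] at this

lemma cosKernel_eq_trigPoly {n p : ℕ} (hnp : n ≤ p) (x : ℝ) :
    (cosKernel n x : ℂ) = trigPoly (Finset.Icc (-p : ℤ) p) (fun k => cosCoeff n k) x := by
  have hc : (n.centralBinom : ℂ) ≠ 0 := by exact_mod_cast n.centralBinom_ne_zero
  have hsub : trigPoly (Finset.Icc (-p : ℤ) p) (fun k => cosCoeff n k) x =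
      ∑ j ∈ Finset.range (2 * n + 1), (cosCoeff n (j - n) : ℂ) * echar (j - n) x := by
    unfold trigPoly
    symm
    refine Finset.sum_of_injOn (fun j : ℕ => (j : ℤ) - n) ?_ ?_ ?_ ?_
    · intro a _ b _ h; simp only at h; omega
    · intro j hj; simp at hj ⊢; omega
    · intro k hk hk'
      simp only
      rw [cosCoeff_eq_zero, Complex.ofReal_zero, zero_mul]
      by_contra hlt
      exact hk' ⟨(k + n).toNat, by simp; omega, by simp only; omega⟩
    · intro j _; rfl
  have hcos : Complex.cos (Real.pi * x) =
      (Complex.exp (Real.pi * Complex.I * x) + Complex.exp (-(Real.pi * Complex.I * x))) / 2 := by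
    rw [Complex.cos, mul_right_comm, neg_mul, mul_right_comm]
  rw [hsub, cosKernel]
  push_cast
  rw [hcos, div_pow, add_pow, pow_mul (2 : ℂ), show (2 : ℂ) ^ 2 = 4 by norm_num,
    div_mul_div_comm, mul_comm (n.centralBinom : ℂ),
    mul_div_mul_left _ _ (pow_ne_zero n (by norm_num : (4 : ℂ) ≠ 0)),
    Finset.sum_div]
  refine Finset.sum_congr rfl fun j hj => ?_
  have hj' : j ≤ 2 * n := by simpa [Nat.lt_succ_iff] using hj
  have hchoose : (2 * n).choose j = (2 * n).choose (n + ((j : ℤ) - n).natAbs) := by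
    rcases le_total n j with h | h
    · congr 1; omega
    · rw [← Nat.choose_symm hj']; congr 1; omega
  have hexp : Complex.exp (Real.pi * Complex.I * x) ^ j *
      Complex.exp (-(Real.pi * Complex.I * x)) ^ (2 * n - j) = echar (j - n) x := by
    rw [← Complex.exp_nat_mul, ← Complex.exp_nat_mul, ← Complex.exp_add, echar,
      Nat.cast_sub hj']
    congr 1; push_cast; ring
  rw [hexp, hchoose, cosCoeff]
  push_cast
  ring

lemma cosKernel_nonneg (n : ℕ) (x : ℝ) : 0 ≤ cosKernel n x := by
  unfold cosKernel
  rw [pow_mul]; positivity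

lemma cosKernel_periodic (n : ℕ) : Function.Periodic (cosKernel n) 1 := by
  intro x
  simp only [cosKernel]
  rw [mul_add, mul_one, Real.cos_add_pi, pow_mul, neg_sq, ← pow_mul]

@[fun_prop]
lemma continuous_cosKernel (n : ℕ) : Continuous (cosKernel n) := by
  unfold cosKernel; fun_prop

lemma sq_four_pow_le_centralBinom {n : ℕ} (hn : 0 < n) :
    ((4 : ℝ) ^ n) ^ 2 ≤ 4 * n * (n.centralBinom : ℝ) ^ 2 := by
  induction n, hn using Nat.le_induction with
  | base => norm_num [Nat.centralBinom, Nat.choose]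
  | succ n hn ih =>
    have hrec : ((n : ℝ) + 1) * (n + 1).centralBinom = 2 * (2 * n + 1) * n.centralBinom := by
      exact_mod_cast Nat.succ_mul_centralBinom_succ n
    have hn' : (0 : ℝ) < n := by exact_mod_cast hn
    have hrec' : ((n + 1).centralBinom : ℝ) = 2 * (2 * n + 1) * n.centralBinom / (n + 1) := by
      field_simp; linarith
    rw [hrec', pow_succ (4 : ℝ) n, mul_pow]
    push_cast
    calc ((4 : ℝ) ^ n) ^ 2 * 4 ^ 2 ≤ 4 * n * (n.centralBinom : ℝ) ^ 2 * 4 ^ 2 := by gcongr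
      _ ≤ _ := by
        rw [div_pow, mul_div_assoc', le_div_iff₀ (by positivity)]
        have : 0 ≤ (n.centralBinom : ℝ) ^ 2 * (n + 1) := by positivity
        nlinarith

lemma cosKernel_sq_le {L : ℕ} (hL : 0 < L) (x : ℝ) :
    cosKernel (L ^ 2) x ≤ 2 * L * Real.cos (Real.pi * x) ^ (2 * L ^ 2) := by
  unfold cosKernel
  have h := sq_four_pow_le_centralBinom (pow_pos hL 2)
  have hc := centralBinom_cast_pos (L ^ 2)
  have : (4 : ℝ) ^ (L ^ 2) / (L ^ 2).centralBinom ≤ 2 * L := by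
    rw [div_le_iff₀ hc]
    refine le_of_sq_le_sq ?_ (by positivity)
    calc _ ≤ _ := h
      _ = _ := by push_cast; ring
  gcongr
  rw [pow_mul]; positivity

lemma cosKernel_le {n : ℕ} (hn : 0 < n) (x : ℝ) :
    cosKernel n x ≤ 2 * n * (Real.cos (Real.pi * x) ^ 2) ^ n := by
  unfold cosKernel
  have hc := centralBinom_cast_pos n
  have h : (4 : ℝ) ^ n ≤ 2 * n * n.centralBinom := by
    exact_mod_cast Nat.four_pow_le_two_mul_self_mul_centralBinom n hn
  rw [pow_mul]
  gcongr
  rwa [div_le_iff₀ hc]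

lemma cos_pi_mul_pow_le {n : ℕ} {r : ℝ} (hr : |r| ≤ 1 / 2) :
    Real.cos (Real.pi * r) ^ (2 * n) ≤ 1 / (1 + 4 * n * r ^ 2) := by
  have hsin : 4 * r ^ 2 ≤ Real.sin (Real.pi * r) ^ 2 := by
    have h := Real.mul_le_sin (x := Real.pi * |r|) (by positivity)
      (by nlinarith [Real.pi_pos])
    have h' : 2 * |r| ≤ Real.sin (Real.pi * |r|) := by
      calc _ = 2 / Real.pi * (Real.pi * |r|) := by field_simp
        _ ≤ _ := h
    have h2 : Real.sin (Real.pi * |r|) ^ 2 = Real.sin (Real.pi * r) ^ 2 := by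
      rcases abs_cases r with ⟨e, _⟩ | ⟨e, _⟩ <;> rw [e]
      rw [mul_neg, Real.sin_neg, neg_sq]
    rw [← h2]
    calc 4 * r ^ 2 = (2 * |r|) ^ 2 := by rw [mul_pow, sq_abs]; norm_num
      _ ≤ _ := by gcongr
  have hcos : Real.cos (Real.pi * r) ^ 2 ≤ 1 - 4 * r ^ 2 := by
    linarith [Real.sin_sq_add_cos_sq (Real.pi * r)]
  have h0 : 0 ≤ 1 - 4 * r ^ 2 := (sq_nonneg _).trans hcos
  rw [pow_mul, le_div_iff₀ (by positivity)]
  calc _ ≤ (1 - 4 * r ^ 2) ^ n * (1 + 4 * r ^ 2) ^ n := by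
        gcongr
        have := one_add_mul_le_pow (a := 4 * r ^ 2) (by nlinarith [sq_nonneg r]) n
        linarith
    _ = (1 - (4 * r ^ 2) ^ 2) ^ n := by rw [← mul_pow]; congr 1; ring
    _ ≤ 1 := pow_le_one₀ (by nlinarith [sq_nonneg r]) (by nlinarith [sq_nonneg r])

/-- The convolution of `μ` with `cosKernel n`. -/
noncomputable def smoothing (μ : Measure ℝ) (n : ℕ) (x : ℝ) : ℝ :=
  ∫ y, cosKernel n (x - y) ∂μ

/-- The Fourier coefficients of `smoothing μ n`. -/
noncomputable def smoothingCoeff (μ : Measure ℝ) (n : ℕ) (k : ℤ) : ℂ :=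
  cosCoeff n k * ftransform μ k

lemma smoothing_eq_trigPoly (μ : Measure ℝ) [IsProbabilityMeasure μ] {n p : ℕ} (hnp : n ≤ p)
    (x : ℝ) :
    (smoothing μ n x : ℂ) = trigPoly (Finset.Icc (-p : ℤ) p) (smoothingCoeff μ n) x := by
  rw [smoothing, ← integral_complex_ofReal]
  simp only [cosKernel_eq_trigPoly hnp, trigPoly]
  have hsplit : ∀ (k : ℤ) (y : ℝ), (cosCoeff n k : ℂ) * echar k (x - y) =
      cosCoeff n k * echar k x *
        Complex.exp ((-2) * (Real.pi : ℂ) * Complex.I * ((k : ℝ) : ℂ) * (y : ℂ)) := by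
    intro k y
    rw [mul_assoc, echar, echar, ← Complex.exp_add]
    congr 2; push_cast; ring
  have hexp : ∀ k : ℤ, Integrable (fun y : ℝ => Complex.exp ((-2) * (Real.pi : ℂ) *
      Complex.I * ((k : ℝ) : ℂ) * (y : ℂ))) μ := by
    intro k
    refine Integrable.of_bound (C := 1) (by fun_prop) (Eventually.of_forall fun y => ?_)
    rw [show (-2) * (Real.pi : ℂ) * Complex.I * ((k : ℝ) : ℂ) * (y : ℂ) =
      ((-2 * Real.pi * k * y : ℝ) : ℂ) * Complex.I by push_cast; ring,
      Complex.norm_exp_ofReal_mul_I]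
  simp only [hsplit]
  rw [integral_finsetSum _ fun k _ => (hexp k).const_mul _]
  refine Finset.sum_congr rfl fun k _ => ?_
  rw [integral_const_mul, smoothingCoeff, ftransform]
  ring

@[fun_prop]
lemma continuous_smoothing (μ : Measure ℝ) [IsProbabilityMeasure μ] (n : ℕ) :
    Continuous (smoothing μ n) := by
  have : smoothing μ n = fun x => (trigPoly (Finset.Icc (-n : ℤ) n) (smoothingCoeff μ n) x).re := by
    ext x
    rw [← smoothing_eq_trigPoly μ le_rfl, Complex.ofReal_re]
  rw [this]
  fun_prop

lemma smoothing_nonneg (μ : Measure ℝ) (n : ℕ) (x : ℝ) : 0 ≤ smoothing μ n x :=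
  integral_nonneg fun _ => cosKernel_nonneg _ _

lemma smoothing_periodic (μ : Measure ℝ) (n : ℕ) : Function.Periodic (smoothing μ n) 1 := by
  intro x
  simp only [smoothing]
  refine integral_congr_ae (Eventually.of_forall fun y => ?_)
  simp only [add_sub_right_comm]
  exact cosKernel_periodic n _

lemma ftransform_zero (μ : Measure ℝ) [IsProbabilityMeasure μ] : ftransform μ 0 = 1 := by
  simp [ftransform]

lemma integral_smoothing (μ : Measure ℝ) [IsProbabilityMeasure μ] (n : ℕ) :
    ∫ x in (0 : ℝ)..1, smoothing μ n x = 1 := by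
  have h : ((∫ x in (0 : ℝ)..1, smoothing μ n x : ℝ) : ℂ) = 1 := by
    rw [← intervalIntegral.integral_ofReal]
    simp only [smoothing_eq_trigPoly μ (le_refl n), trigPoly]
    rw [intervalIntegral.integral_finsetSum
      (fun _ _ => (by fun_prop : Continuous _).intervalIntegrable _ _)]
    simp only [intervalIntegral.integral_const_mul, integral_echar]
    simp [smoothingCoeff, cosCoeff_zero, ftransform_zero]
  exact_mod_cast h

lemma sum_range_one_div_one_add_four_mul_sq_le (n : ℕ) :
    ∑ j ∈ Finset.range (n + 1), 1 / (1 + 4 * (j : ℝ) ^ 2) ≤ 2 - 1 / ((n : ℝ) + 1) := by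
  induction n with
  | zero => norm_num
  | succ n ih =>
    rw [Finset.sum_range_succ]
    have h : 1 / (1 + 4 * ((n + 1 : ℕ) : ℝ) ^ 2) ≤ 1 / (n + 1) - 1 / ((n + 1 : ℕ) + 1) := by
      push_cast
      rw [div_sub_div _ _ (by positivity) (by positivity)]
      rw [div_le_div_iff₀ (by positivity) (by positivity)]
      nlinarith [(Nat.cast_nonneg n : (0 : ℝ) ≤ n)]
    linarith

lemma sub_intCast_eq_of_periodic_one {F : ℝ → ℝ} (hF : Function.Periodic F 1) (n : ℤ) (x : ℝ) :
    F (x - n) = F x := by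
  simpa using hF.sub_int_mul_eq (x := x) n

/-- A ball condition of exponent `α` bounds the smoothing at scale `1 / L` by `L ^ (1 - α)`. -/
lemma smoothing_sq_le {C α : ℝ} {μ : Measure ℝ} [IsProbabilityMeasure μ]
    (hsupp : ∀ᵐ y ∂μ, y ∈ Icc (0 : ℝ) 1)
    (hball : ∀ x : ℝ, ∀ ε : ℝ, 0 < ε → ε ≤ 1 → (μ (Icc x (x + ε))).toReal ≤ C * ε ^ α)
    (hC : 0 < C) {L : ℕ} (hL : 0 < L) (x : ℝ) :
    smoothing μ (L ^ 2) x ≤ 24 * C * (L : ℝ) ^ (1 - α) := by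
  wlog hx : x ∈ Icc (0 : ℝ) 1 generalizing x
  · have h := this (Int.fract x) ⟨Int.fract_nonneg x, (Int.fract_lt_one x).le⟩
    rwa [Int.fract, sub_intCast_eq_of_periodic_one (smoothing_periodic μ (L ^ 2))] at h
  have hLpos : (0 : ℝ) < L := by exact_mod_cast hL
  have hL1 : (1 : ℝ) ≤ L := by exact_mod_cast hL
  set tile : ℤ → ℕ → ℝ → ℝ := fun a j y =>
    (Icc (x - a - (j + 1) / L) (x - a - (j + 1) / L + 1 / L)).indicator 1 y +
      (Icc (x - a + j / L) (x - a + j / L + 1 / L)).indicator 1 y with htile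
  have hind : ∀ z : ℝ, Integrable ((Icc z (z + 1 / L)).indicator (1 : ℝ → ℝ)) μ := fun z =>
    (integrable_const (1 : ℝ)).indicator measurableSet_Icc
  have hindle : ∀ z : ℝ, ∫ y, (Icc z (z + 1 / L)).indicator (1 : ℝ → ℝ) y ∂μ ≤
      C * (1 / L) ^ α := by
    intro z
    rw [integral_indicator_one measurableSet_Icc]
    exact hball z (1 / L) (by positivity) (div_le_one_of_le₀ hL1 hLpos.le)
  have htile0 : ∀ a j y, 0 ≤ tile a j y := fun a j y =>
    add_nonneg (indicator_nonneg (fun _ _ => zero_le_one) _)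
      (indicator_nonneg (fun _ _ => zero_le_one) _)
  have htilei : ∀ a j, Integrable (tile a j) μ := fun a j => (hind _).add (hind _)
  have htilele : ∀ a j, ∫ y, tile a j y ∂μ ≤ 2 * (C * (1 / L) ^ α) := by
    intro a j
    rw [htile]
    rw [integral_add (hind _) (hind _)]
    linarith [hindle (x - a - (j + 1) / L), hindle (x - a + j / L)]
  have hpt : ∀ y ∈ Icc (0 : ℝ) 1, cosKernel (L ^ 2) (x - y) ≤
      ∑ a ∈ Finset.Icc (-1 : ℤ) 1, ∑ j ∈ Finset.range (L + 1),
        2 * L * (1 / (1 + 4 * (j : ℝ) ^ 2)) * tile a j y := by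
    intro y hy
    set a := round (x - y) with ha
    set r := x - y - a with hr
    have hrhalf : |r| ≤ 1 / 2 := abs_sub_round (x - y)
    have hra := abs_le.1 hrhalf
    have ha1 : (a : ℝ) < 2 := by linarith [hx.2, hy.1]
    have ha2 : (-2 : ℝ) < a := by linarith [hx.1, hy.2]
    have ha1' : a < 2 := by exact_mod_cast ha1
    have ha2' : -2 < a := by exact_mod_cast ha2
    set j := ⌊|r| * L⌋₊ with hj
    have hj1 : (j : ℝ) ≤ |r| * L := Nat.floor_le (by positivity)
    have hj2 : |r| * L < j + 1 := Nat.lt_floor_add_one _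
    have hjL : j < L + 1 := by
      have : (j : ℝ) < L + 1 := by nlinarith
      exact_mod_cast this
    have hj1' : j / L ≤ |r| := by rwa [div_le_iff₀ hLpos]
    have hj2' : |r| ≤ j / L + 1 / L := by
      rw [← add_div, le_div_iff₀ hLpos]; exact hj2.le
    have htile1 : 1 ≤ tile a j y := by
      simp only [htile]
      rcases abs_cases r with ⟨e, _⟩ | ⟨e, _⟩
      · have : y ∈ Icc (x - a - (j + 1) / L) (x - a - (j + 1) / L + 1 / L) := by
          constructor
          · rw [add_div]; linarith
          · rw [add_div]; linarith
        rw [indicator_of_mem this]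
        have := indicator_nonneg (s := Icc (x - a + j / L) (x - a + j / L + 1 / L))
          (f := (1 : ℝ → ℝ)) (fun _ _ => zero_le_one) y
        simpa using this
      · have : y ∈ Icc (x - a + j / L) (x - a + j / L + 1 / L) := by
          constructor <;> linarith
        rw [indicator_of_mem this]
        have := indicator_nonneg (s := Icc (x - a - (j + 1) / L) (x - a - (j + 1) / L + 1 / L))
          (f := (1 : ℝ → ℝ)) (fun _ _ => zero_le_one) y
        simpa using this
    have hterm : ∀ (a : ℤ) (j : ℕ), 0 ≤ 2 * L * (1 / (1 + 4 * (j : ℝ) ^ 2)) * tile a j y :=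
      fun a j => mul_nonneg (by positivity) (htile0 a j y)
    have hker : cosKernel (L ^ 2) (x - y) = cosKernel (L ^ 2) r := by
      rw [hr, sub_intCast_eq_of_periodic_one (cosKernel_periodic (L ^ 2))]
    calc cosKernel (L ^ 2) (x - y) ≤ 2 * L * Real.cos (Real.pi * r) ^ (2 * L ^ 2) :=
          hker ▸ cosKernel_sq_le hL r
      _ ≤ 2 * L * (1 / (1 + 4 * (L ^ 2 : ℕ) * r ^ 2)) := by
          gcongr; exact cos_pi_mul_pow_le hrhalf
      _ ≤ 2 * L * (1 / (1 + 4 * (j : ℝ) ^ 2)) := by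
          gcongr 2 * L * (1 / (1 + ?_))
          calc 4 * (j : ℝ) ^ 2 ≤ 4 * (|r| * L) ^ 2 := by gcongr
            _ = 4 * (L ^ 2 : ℕ) * r ^ 2 := by rw [mul_pow, sq_abs]; push_cast; ring
      _ ≤ 2 * L * (1 / (1 + 4 * (j : ℝ) ^ 2)) * tile a j y :=
          le_mul_of_one_le_right (by positivity) htile1
      _ ≤ ∑ j ∈ Finset.range (L + 1), 2 * L * (1 / (1 + 4 * (j : ℝ) ^ 2)) * tile a j y :=
          Finset.single_le_sum
            (f := fun j : ℕ => 2 * L * (1 / (1 + 4 * (j : ℝ) ^ 2)) * tile a j y)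
            (fun j _ => hterm a j) (Finset.mem_range.2 hjL)
      _ ≤ _ := Finset.single_le_sum (f := fun a => ∑ j ∈ Finset.range (L + 1),
              2 * L * (1 / (1 + 4 * (j : ℝ) ^ 2)) * tile a j y)
            (fun a _ => Finset.sum_nonneg fun j _ => hterm a j)
            (Finset.mem_Icc.2 ⟨by omega, by omega⟩)
  have hsumi : ∀ a ∈ Finset.Icc (-1 : ℤ) 1, Integrable (fun y => ∑ j ∈ Finset.range (L + 1),
      2 * L * (1 / (1 + 4 * (j : ℝ) ^ 2)) * tile a j y) μ := fun a _ =>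
    integrable_finsetSum _ fun j _ => (htilei a j).const_mul _
  have hbound : smoothing μ (L ^ 2) x ≤ ∑ a ∈ Finset.Icc (-1 : ℤ) 1,
      ∑ j ∈ Finset.range (L + 1), 2 * L * (1 / (1 + 4 * (j : ℝ) ^ 2)) *
        (2 * (C * (1 / L) ^ α)) := by
    calc smoothing μ (L ^ 2) x ≤ ∫ y, ∑ a ∈ Finset.Icc (-1 : ℤ) 1, ∑ j ∈ Finset.range (L + 1),
          2 * L * (1 / (1 + 4 * (j : ℝ) ^ 2)) * tile a j y ∂μ :=
          integral_mono_of_nonneg (Eventually.of_forall fun y => cosKernel_nonneg _ _)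
            (integrable_finsetSum _ hsumi) (hsupp.mono hpt)
      _ = ∑ a ∈ Finset.Icc (-1 : ℤ) 1, ∑ j ∈ Finset.range (L + 1),
          2 * L * (1 / (1 + 4 * (j : ℝ) ^ 2)) * ∫ y, tile a j y ∂μ := by
          rw [integral_finsetSum _ hsumi]
          refine Finset.sum_congr rfl fun a _ => ?_
          rw [integral_finsetSum _ fun j _ => (htilei a j).const_mul _]
          simp only [integral_const_mul]
      _ ≤ _ := by
          gcongr with a _ j _
          exact htilele a j
  refine hbound.trans ?_
  rw [Finset.sum_const, ← Finset.sum_mul, ← Finset.mul_sum]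
  have hs : ∑ j ∈ Finset.range (L + 1), 1 / (1 + 4 * (j : ℝ) ^ 2) ≤ 2 :=
    (sum_range_one_div_one_add_four_mul_sq_le L).trans 
      (by linarith [show (0 : ℝ) ≤ 1 / (L + 1) by positivity])
  have hpow : (L : ℝ) ^ (1 - α) = L * (1 / L) ^ α := by
    rw [Real.rpow_sub hLpos, Real.rpow_one, one_div, Real.inv_rpow hLpos.le, div_eq_mul_inv]
  have hcard : (Finset.Icc (-1 : ℤ) 1).card = 3 := rfl
  rw [hcard, hpow, nsmul_eq_mul]
  calc _ ≤ ((3 : ℕ) : ℝ) * (2 * L * 2 * (2 * (C * (1 / L) ^ α))) := by gcongr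
    _ = _ := by push_cast; ring

/-- The integral of a function of `(d, x)` over the unit square. -/
noncomputable def squareIntegral {V : Type*} [NormedAddCommGroup V] [NormedSpace ℝ V]
    (F : ℝ → ℝ → V) : V :=
  ∫ d in (0 : ℝ)..1, ∫ x in (0 : ℝ)..1, F d x

lemma continuous_inner_integral {V : Type*} [NormedAddCommGroup V] [NormedSpace ℝ V]
    {F : ℝ → ℝ → V} (hF : Continuous (Function.uncurry F)) :
    Continuous fun d => ∫ x in (0 : ℝ)..1, F d x :=
  intervalIntegral.continuous_parametric_intervalIntegral_of_continuous' hF 0 1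

lemma squareIntegral_add {V : Type*} [NormedAddCommGroup V] [NormedSpace ℝ V]
    {F G : ℝ → ℝ → V} (hF : Continuous (Function.uncurry F))
    (hG : Continuous (Function.uncurry G)) :
    squareIntegral (fun d x => F d x + G d x) = squareIntegral F + squareIntegral G := by
  unfold squareIntegral
  rw [← intervalIntegral.integral_add ((continuous_inner_integral hF).intervalIntegrable _ _)
    ((continuous_inner_integral hG).intervalIntegrable _ _)]
  refine intervalIntegral.integral_congr fun d _ => ?_
  exact intervalIntegral.integral_add ((hF.uncurry_left d).intervalIntegrable _ _)
    ((hG.uncurry_left d).intervalIntegrable _ _)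

lemma squareIntegral_sum_mul {ι : Type*} (T : Finset ι) (c : ι → ℂ) {F : ι → ℝ → ℝ → ℂ}
    (hF : ∀ t, Continuous (Function.uncurry (F t))) :
    squareIntegral (fun d x => ∑ t ∈ T, c t * F t d x) = ∑ t ∈ T, c t * squareIntegral (F t) := by
  unfold squareIntegral
  have hx : ∀ d, ∫ x in (0 : ℝ)..1, ∑ t ∈ T, c t * F t d x =
      ∑ t ∈ T, c t * ∫ x in (0 : ℝ)..1, F t d x := by
    intro d
    rw [intervalIntegral.integral_finsetSum fun t _ =>
      ((hF t).uncurry_left d).intervalIntegrable _ _ |>.const_mul (c t)]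
    simp only [intervalIntegral.integral_const_mul]
  simp only [hx]
  rw [intervalIntegral.integral_finsetSum fun t _ =>
    ((continuous_inner_integral (hF t)).intervalIntegrable _ _).const_mul (c t)]
  simp only [intervalIntegral.integral_const_mul]

lemma re_squareIntegral {F : ℝ → ℝ → ℂ} (hF : Continuous (Function.uncurry F)) :
    (squareIntegral F).re = squareIntegral fun d x => (F d x).re := by
  unfold squareIntegral
  have h1 := Complex.reCLM.intervalIntegral_comp_comm
    ((continuous_inner_integral hF).intervalIntegrable (μ := volume) 0 1)
  simp only [Complex.reCLM_apply] at h1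
  rw [← h1]
  refine intervalIntegral.integral_congr fun d _ => ?_
  have h2 := Complex.reCLM.intervalIntegral_comp_comm
    ((hF.uncurry_left d).intervalIntegrable (μ := volume) 0 1)
  simpa only [Complex.reCLM_apply] using h2.symm

lemma squareIntegral_mono {F G : ℝ → ℝ → ℝ} (hF : Continuous (Function.uncurry F))
    (hG : Continuous (Function.uncurry G))
    (h : ∀ d ∈ Icc (0 : ℝ) 1, ∀ x ∈ Icc (0 : ℝ) 1, F d x ≤ G d x) :
    squareIntegral F ≤ squareIntegral G :=
  intervalIntegral.integral_mono_on zero_le_one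
    ((continuous_inner_integral hF).intervalIntegrable _ _)
    ((continuous_inner_integral hG).intervalIntegrable _ _) fun d hd =>
    intervalIntegral.integral_mono_on zero_le_one
      ((hF.uncurry_left d).intervalIntegrable _ _)
      ((hG.uncurry_left d).intervalIntegrable _ _) fun x hx => h d hd x hx

lemma squareIntegral_const (r : ℝ) : squareIntegral (fun _ _ => r) = r := by
  simp [squareIntegral]

/-- Majorant of the Fourier coefficients: `|k|^{-γ}`, with value one at `k = 0`. -/
noncomputable def decay (γ : ℝ) (k : ℤ) : ℝ := |(k : ℝ)| ^ (-γ) + if k = 0 then 1 else 0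

lemma decay_nonneg (γ : ℝ) (k : ℤ) : 0 ≤ decay γ k := by
  unfold decay; split_ifs <;> positivity

lemma decay_zero {γ : ℝ} (hγ : 0 < γ) : decay γ 0 = 1 := by
  simp [decay, Real.zero_rpow (neg_ne_zero.2 hγ.ne')]

lemma decay_of_ne_zero (γ : ℝ) {k : ℤ} (hk : k ≠ 0) : decay γ k = |(k : ℝ)| ^ (-γ) := by
  simp [decay, hk]

lemma summable_decay_pow_three {γ : ℝ} (hγ : 1 / 3 < γ) : Summable fun k => decay γ k ^ 3 := by
  have h1 : Summable fun k : ℤ => |(k : ℝ)| ^ (-(3 * γ)) :=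
    Real.summable_abs_int_rpow (by linarith)
  have h2 : Summable fun k : ℤ => if k = 0 then (1 : ℝ) else 0 :=
    summable_of_ne_finset_zero (s := {0}) fun k hk => by simp at hk; simp [hk]
  refine (h1.add h2).congr fun k => ?_
  by_cases hk : k = 0
  · rw [hk, decay_zero (by linarith)]
    simp [Real.zero_rpow (by linarith : -(3 * γ) ≠ 0)]
  · rw [decay_of_ne_zero γ hk, if_neg hk, add_zero, ← Real.rpow_natCast, ← Real.rpow_mul
      (abs_nonneg _)]
    congr 1; push_cast; ring

lemma norm_smoothingCoeff_le {μ : Measure ℝ} [IsProbabilityMeasure μ] {D η γ : ℝ} (hD : 1 ≤ D)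
    (hγ : 0 < γ) (hγη : γ ≤ η) (hμ : ∀ k : ℤ, k ≠ 0 → ‖ftransform μ k‖ ≤ D * |(k : ℝ)| ^ (-η))
    (n : ℕ) (k : ℤ) : ‖smoothingCoeff μ n k‖ ≤ D * decay γ k := by
  rw [smoothingCoeff, norm_mul, Complex.norm_real, Real.norm_of_nonneg (cosCoeff_nonneg n k)]
  by_cases hk : k = 0
  · subst hk
    simp [decay_zero hγ, cosCoeff_zero, ftransform_zero, hD]
  · have hk1 : 1 ≤ |(k : ℝ)| := by exact_mod_cast Int.one_le_abs hk
    rw [decay_of_ne_zero γ hk]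
    calc _ ≤ 1 * (D * |(k : ℝ)| ^ (-η)) := by
          gcongr
          · exact cosCoeff_le_one n k
          · exact hμ k hk
      _ ≤ D * |(k : ℝ)| ^ (-γ) := by
          rw [one_mul]; gcongr

lemma norm_smoothingCoeff_sub_le {μ : Measure ℝ} {D s γ : ℝ} (hD : 0 ≤ D) (hs : 0 < s)
    (hs1 : s ≤ 1)
    (hμ : ∀ k : ℤ, k ≠ 0 → ‖ftransform μ k‖ ≤ D * |(k : ℝ)| ^ (-(γ + 2 * s)))
    {n N : ℕ} (hN : 0 < N) (hNn : N ≤ n) (k : ℤ) :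
    ‖smoothingCoeff μ n k - smoothingCoeff μ N k‖ ≤ D * (N : ℝ) ^ (-s) * decay γ k := by
  have hNpos : (0 : ℝ) < N := by exact_mod_cast hN
  have hNn' : (N : ℝ) ≤ n := by exact_mod_cast hNn
  rw [smoothingCoeff, smoothingCoeff, ← sub_mul, ← Complex.ofReal_sub, norm_mul,
    Complex.norm_real, Real.norm_eq_abs]
  by_cases hk : k = 0
  · subst hk
    simp only [cosCoeff_zero, sub_self, abs_zero, zero_mul]
    exact mul_nonneg (by positivity) (decay_nonneg _ _)
  · have hk1 : 1 ≤ |(k : ℝ)| := by exact_mod_cast Int.one_le_abs hk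
    have hkpos : 0 < |(k : ℝ)| := by linarith
    have hle1 : |cosCoeff n k - cosCoeff N k| ≤ 1 := by
      rw [abs_le]
      constructor <;> linarith [cosCoeff_nonneg n k, cosCoeff_le_one n k, cosCoeff_nonneg N k,
        cosCoeff_le_one N k]
    have hle2 : |cosCoeff n k - cosCoeff N k| ≤ (k : ℝ) ^ 2 / N := by
      have h1 := one_sub_cosCoeff_le (hN.trans_le hNn) k
      have h2 := one_sub_cosCoeff_le hN k
      have h3 : (k : ℝ) ^ 2 / n ≤ (k : ℝ) ^ 2 / N := by gcongr
      rw [abs_le]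
      constructor <;> linarith [cosCoeff_le_one n k, cosCoeff_le_one N k]
    have hle3 : |cosCoeff n k - cosCoeff N k| ≤ |(k : ℝ)| ^ (2 * s) * (N : ℝ) ^ (-s) := by
      have hrhs : |(k : ℝ)| ^ (2 * s) * (N : ℝ) ^ (-s) = ((k : ℝ) ^ 2 / N) ^ s := by
        rw [Real.div_rpow (sq_nonneg _) hNpos.le, Real.rpow_neg hNpos.le, ← sq_abs,
          Real.rpow_mul hkpos.le, Real.rpow_two, div_eq_mul_inv]
      rw [hrhs]
      calc |cosCoeff n k - cosCoeff N k| ≤ |cosCoeff n k - cosCoeff N k| ^ s :=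
            Real.self_le_rpow_of_le_one (abs_nonneg _) hle1 hs1
        _ ≤ _ := by gcongr
    rw [decay_of_ne_zero γ hk]
    calc _ ≤ (|(k : ℝ)| ^ (2 * s) * (N : ℝ) ^ (-s)) * (D * |(k : ℝ)| ^ (-(γ + 2 * s))) := by
          gcongr
          exact hμ k hk
      _ = D * (N : ℝ) ^ (-s) * (|(k : ℝ)| ^ (2 * s) * |(k : ℝ)| ^ (-(γ + 2 * s))) := by ring
      _ = _ := by rw [← Real.rpow_add hkpos]; congr 2; ring

/-- The product of the values of `f` along the progression `x, x + d, x + 2d`. -/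
def progressionProduct {R : Type*} [Mul R] (f : ℝ → R) (d x : ℝ) : R :=
  f x * f (x + d) * f (x + 2 * d)

lemma trigPoly_sub (S : Finset ℤ) (a b : ℤ → ℂ) (x : ℝ) :
    trigPoly S (fun k => a k - b k) x = trigPoly S a x - trigPoly S b x := by
  simp only [trigPoly, sub_mul, Finset.sum_sub_distrib]

/-- Comparison of the progression counts of two smoothings, against a trigonometric weight. -/
lemma norm_squareIntegral_progressionProduct_sub_le {μ : Measure ℝ} [IsProbabilityMeasure μ]
    {D s γ : ℝ} (hD : 1 ≤ D) (hs : 0 < s) (hs1 : s ≤ 1) (hγ : 1 / 3 < γ)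
    (hμ : ∀ k : ℤ, k ≠ 0 → ‖ftransform μ k‖ ≤ D * |(k : ℝ)| ^ (-(γ + 2 * s)))
    {n N : ℕ} (hN : 0 < N) (hNn : N ≤ n) (T : Finset (Fin 2 → ℤ)) (c : (Fin 2 → ℤ) → ℂ) :
    ‖squareIntegral (fun d x => ∑ t ∈ T, c t *
      (((progressionProduct (smoothing μ n) d x - progressionProduct (smoothing μ N) d x : ℝ) : ℂ)
        * (echar (t 0) x * echar (t 1) d)))‖ ≤
    (∑ t ∈ T, ‖c t‖) * (3 * (D ^ 3 * (N : ℝ) ^ (-s) * ∑' k, decay γ k ^ 3)) := by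
  rw [squareIntegral_sum_mul T c fun t => by
    unfold Function.uncurry progressionProduct; fun_prop, Finset.sum_mul]
  refine (norm_sum_le _ _).trans (Finset.sum_le_sum fun t _ => ?_)
  rw [norm_mul]
  gcongr
  set S := Finset.Icc (-n : ℤ) n
  set a := smoothingCoeff μ n
  set b := smoothingCoeff μ N
  have ha : ∀ k, ‖a k‖ ≤ D * decay γ k :=
    norm_smoothingCoeff_le hD (by linarith) (by linarith) hμ n
  have hb : ∀ k, ‖b k‖ ≤ D * decay γ k :=
    norm_smoothingCoeff_le hD (by linarith) (by linarith) hμ N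
  have hab : ∀ k, ‖a k - b k‖ ≤ D * (N : ℝ) ^ (-s) * decay γ k :=
    norm_smoothingCoeff_sub_le (by linarith) hs hs1 hμ hN hNn
  have hD0 : 0 ≤ D := by linarith
  have hDN : 0 ≤ D * (N : ℝ) ^ (-s) := by positivity
  have hsum := summable_decay_pow_three hγ
  have h1 := norm_integral_progression_le (decay_nonneg γ) hsum hDN hD0 hD0 hab ha ha S (t 0) (t 1)
  have h2 := norm_integral_progression_le (decay_nonneg γ) hsum hD0 hDN hD0 hb hab ha S (t 0) (t 1)
  have h3 := norm_integral_progression_le (decay_nonneg γ) hsum hD0 hD0 hDN hb hb hab S (t 0) (t 1)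
  have hsplit : (fun d x => ((progressionProduct (smoothing μ n) d x -
        progressionProduct (smoothing μ N) d x : ℝ) : ℂ) * (echar (t 0) x * echar (t 1) d)) =
      fun d x =>
        (trigPoly S (fun k => a k - b k) x * trigPoly S a (x + d) * trigPoly S a (x + 2 * d) *
          (echar (t 0) x * echar (t 1) d) +
        trigPoly S b x * trigPoly S (fun k => a k - b k) (x + d) * trigPoly S a (x + 2 * d) *
          (echar (t 0) x * echar (t 1) d)) +
        trigPoly S b x * trigPoly S b (x + d) * trigPoly S (fun k => a k - b k) (x + 2 * d) *
          (echar (t 0) x * echar (t 1) d) := by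
    funext d x
    simp only [progressionProduct, Complex.ofReal_sub, Complex.ofReal_mul,
      smoothing_eq_trigPoly μ (le_refl n), smoothing_eq_trigPoly μ hNn, trigPoly_sub]
    ring
  rw [hsplit, squareIntegral_add (by unfold Function.uncurry; fun_prop)
      (by unfold Function.uncurry; fun_prop),
    squareIntegral_add (by unfold Function.uncurry; fun_prop)
      (by unfold Function.uncurry; fun_prop)]
  refine (norm_add₃_le).trans ?_
  calc _ ≤ _ := add_le_add (add_le_add h1 h2) h3
    _ = _ := by ring

lemma echar_eq_fourier (k : ℤ) (x : ℝ) : echar k x = fourier k (x : UnitAddCircle) := by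
  rw [fourier_coe_apply, echar]
  simp

/-- A continuous weight on the torus is bounded below by a trigonometric polynomial
that is uniformly close to it. -/
lemma exists_trig_minorant (u v : C(UnitAddCircle, ℝ)) {ε : ℝ} (hε : 0 < ε) :
    ∃ (T : Finset (Fin 2 → ℤ)) (c : (Fin 2 → ℤ) → ℂ), ∀ x d : ℝ,
      u x * v d - 2 * ε ≤ (∑ t ∈ T, c t * (echar (t 0) x * echar (t 1) d)).re ∧
      (∑ t ∈ T, c t * (echar (t 0) x * echar (t 1) d)).re ≤ u x * v d := by
  let F : C(UnitAddTorus (Fin 2), ℂ) :=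
    ⟨fun z => ((u (z 0) * v (z 1) - ε : ℝ) : ℂ), by fun_prop⟩
  have hF : F ∈ (Submodule.span ℂ
      (range (UnitAddTorus.mFourier (d := Fin 2)))).topologicalClosure := by
    rw [UnitAddTorus.span_mFourier_closure_eq_top]; trivial
  obtain ⟨G, hG, hFG⟩ := Metric.mem_closure_iff.1 hF ε hε
  obtain ⟨c, rfl⟩ := (Finsupp.mem_span_range_iff_exists_finsupp).1 hG
  refine ⟨c.support, c, fun x d => ?_⟩
  have hval : (c.sum fun t a => a • UnitAddTorus.mFourier t)
      (![(x : UnitAddCircle), (d : UnitAddCircle)]) =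
      ∑ t ∈ c.support, c t * (echar (t 0) x * echar (t 1) d) := by
    simp [Finsupp.sum, ContinuousMap.sum_apply, UnitAddTorus.mFourier, echar_eq_fourier]
  have hFval : F (![(x : UnitAddCircle), (d : UnitAddCircle)]) =
      ((u x * v d - ε : ℝ) : ℂ) := by simp [F]
  have hdist := (ContinuousMap.dist_apply_le_dist
    (![(x : UnitAddCircle), (d : UnitAddCircle)])).trans_lt hFG
  rw [hval, hFval, dist_eq_norm] at hdist
  have hre := (Complex.abs_re_le_norm _).trans hdist.le
  rw [Complex.sub_re, Complex.ofReal_re, abs_le] at hre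
  constructor <;> linarith [hre.1, hre.2]

/-- A continuous function on the circle vanishing within `ρ` of the origin and equal to one
further than `2ρ` from it. -/
noncomputable def farWeight (ρ : ℝ) : C(UnitAddCircle, ℝ) :=
  ⟨fun z => max 0 (min 1 (‖z‖ / ρ - 1)), by fun_prop⟩

/-- A continuous function on the circle supported in the annulus `τ / 2 ≤ ‖z‖ ≤ 2κ` and equal to
one where `τ ≤ ‖z‖ ≤ κ`. -/
noncomputable def annulusWeight (τ κ : ℝ) : C(UnitAddCircle, ℝ) :=
  ⟨fun z => max 0 (min 1 (min (2 * ‖z‖ / τ - 1) (2 - ‖z‖ / κ))), by fun_prop⟩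

lemma farWeight_nonneg (ρ : ℝ) (z : UnitAddCircle) : 0 ≤ farWeight ρ z := le_max_left _ _

lemma farWeight_le_one (ρ : ℝ) (z : UnitAddCircle) : farWeight ρ z ≤ 1 :=
  max_le zero_le_one (min_le_left _ _)

lemma annulusWeight_nonneg (τ κ : ℝ) (z : UnitAddCircle) : 0 ≤ annulusWeight τ κ z :=
  le_max_left _ _

lemma annulusWeight_le_one (τ κ : ℝ) (z : UnitAddCircle) : annulusWeight τ κ z ≤ 1 :=
  max_le zero_le_one (min_le_left _ _)

lemma farWeight_eq_one {ρ : ℝ} (hρ : 0 < ρ) {z : UnitAddCircle} (hz : 2 * ρ ≤ ‖z‖) :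
    farWeight ρ z = 1 := by
  have : 1 ≤ ‖z‖ / ρ - 1 := by
    rw [le_sub_iff_add_le, le_div_iff₀ hρ]; linarith
  simp [farWeight, min_eq_left this]

lemma le_norm_of_farWeight_pos {ρ : ℝ} (hρ : 0 < ρ) {z : UnitAddCircle}
    (hz : 0 < farWeight ρ z) : ρ ≤ ‖z‖ := by
  have h : 0 < max 0 (min 1 (‖z‖ / ρ - 1)) := hz
  have h1 : 0 < ‖z‖ / ρ - 1 := by
    rcases lt_max_iff.1 h with h | h
    · exact absurd h (lt_irrefl _)
    · exact (lt_min_iff.1 h).2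
  rw [lt_sub_iff_add_lt, lt_div_iff₀ hρ] at h1
  linarith

lemma annulusWeight_eq_one {τ κ : ℝ} (hτ : 0 < τ) (hκ : 0 < κ) {z : UnitAddCircle}
    (h1 : τ ≤ ‖z‖) (h2 : ‖z‖ ≤ κ) : annulusWeight τ κ z = 1 := by
  have h3 : 1 ≤ 2 * ‖z‖ / τ - 1 := by
    rw [le_sub_iff_add_le, le_div_iff₀ hτ]; linarith
  have h4 : 1 ≤ 2 - ‖z‖ / κ := by
    have := div_le_one_of_le₀ h2 hκ.le; linarith
  simp [annulusWeight, min_eq_left (le_min h3 h4)]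

lemma norm_mem_of_annulusWeight_pos {τ κ : ℝ} (hτ : 0 < τ) (hκ : 0 < κ) {z : UnitAddCircle}
    (hz : 0 < annulusWeight τ κ z) : τ / 2 ≤ ‖z‖ ∧ ‖z‖ ≤ 2 * κ := by
  have h : 0 < max 0 (min 1 (min (2 * ‖z‖ / τ - 1) (2 - ‖z‖ / κ))) := hz
  rcases lt_max_iff.1 h with h | h
  · exact absurd h (lt_irrefl _)
  obtain ⟨h1, h2⟩ := lt_min_iff.1 (lt_min_iff.1 h).2
  rw [lt_sub_iff_add_lt, lt_div_iff₀ hτ] at h1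
  rw [sub_pos, div_lt_iff₀ hκ] at h2
  constructor <;> linarith

lemma unitAddCircle_norm_le_abs_sub_intCast (x : ℝ) (n : ℤ) :
    ‖(x : UnitAddCircle)‖ ≤ |x - n| := by
  rw [UnitAddCircle.norm_eq]; exact round_le x n

lemma le_unitAddCircle_norm {x θ : ℝ} (h0 : θ ≤ x) (h1 : x ≤ 1 - θ) (hx : x ∈ Icc (0 : ℝ) 1) :
    θ ≤ ‖(x : UnitAddCircle)‖ := by
  rcases hx.2.lt_or_eq with hlt | rfl
  · rw [UnitAddCircle.norm_eq, abs_sub_round_eq_min, Int.fract_eq_self.2 ⟨hx.1, hlt⟩]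
    exact le_min h0 (by linarith)
  · exact (by linarith : θ ≤ 0).trans (norm_nonneg _)

lemma le_integral_farWeight {ρ : ℝ} (hρ : 0 < ρ) (hρ4 : ρ ≤ 1 / 4) :
    1 - 4 * ρ ≤ ∫ x in (0 : ℝ)..1, farWeight ρ x := by
  have hc : Continuous fun x : ℝ => farWeight ρ x := by fun_prop
  calc 1 - 4 * ρ = ∫ x in (2 * ρ)..(1 - 2 * ρ), (1 : ℝ) := by
        rw [intervalIntegral.integral_const, smul_eq_mul]; ring
    _ = ∫ x in (2 * ρ)..(1 - 2 * ρ), farWeight ρ x := by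
        refine intervalIntegral.integral_congr fun x hx => ?_
        rw [uIcc_of_le (by linarith)] at hx
        exact (farWeight_eq_one hρ (le_unitAddCircle_norm hx.1 hx.2
          ⟨by linarith [hx.1], by linarith [hx.2]⟩)).symm
    _ ≤ _ := intervalIntegral.integral_mono_interval (by linarith) (by linarith) (by linarith)
        (Eventually.of_forall fun x => farWeight_nonneg ρ x) (hc.intervalIntegrable _ _)

/-- Absence of progressions in a compact set is stable: some point of every progression with
base in a bounded interval and difference bounded away from zero stays far from the set. -/
lemma exists_le_infDist_of_no_progression {E : Set ℝ} (hE : IsClosed E) (hne : E.Nonempty)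
    (hno : ¬ ∃ x d : ℝ, d ≠ 0 ∧ x ∈ E ∧ x + d ∈ E ∧ x + 2 * d ∈ E) (A B κ : ℝ) {τ : ℝ}
    (hτ : 0 < τ) :
    ∃ η > 0, ∀ x ∈ Icc A B, ∀ d : ℝ, τ ≤ |d| → |d| ≤ κ →
      η ≤ Metric.infDist x E ∨ η ≤ Metric.infDist (x + d) E ∨
        η ≤ Metric.infDist (x + 2 * d) E := by
  set F : ℝ × ℝ → ℝ := fun p => Metric.infDist p.1 E + Metric.infDist (p.1 + p.2) E +
    Metric.infDist (p.1 + 2 * p.2) E with hFdef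
  have hF : Continuous F :=
    (((Metric.continuous_infDist_pt E).comp (by fun_prop)).add
      ((Metric.continuous_infDist_pt E).comp (by fun_prop))).add
      ((Metric.continuous_infDist_pt E).comp (by fun_prop))
  have hQ : IsCompact (Icc A B ×ˢ (Icc (-κ) κ ∩ {d : ℝ | τ ≤ |d|})) :=
    isCompact_Icc.prod (isCompact_Icc.inter_right (isClosed_le continuous_const continuous_abs))
  obtain ⟨η, hη, hmin⟩ := hQ.exists_forall_le' hF.continuousOn (a := 0) fun p hp => by
    have hd : p.2 ≠ 0 := by
      intro h
      have := hp.2.2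
      simp only [mem_ofPred_eq, h, abs_zero] at this
      linarith
    have h1 := Metric.infDist_nonneg (x := p.1) (s := E)
    have h2 := Metric.infDist_nonneg (x := p.1 + p.2) (s := E)
    have h3 := Metric.infDist_nonneg (x := p.1 + 2 * p.2) (s := E)
    by_contra hle
    simp only [hFdef, not_lt] at hle
    refine hno ⟨p.1, p.2, hd, ?_, ?_, ?_⟩ <;>
      refine (hE.mem_iff_infDist_zero hne).2 ?_ <;> linarith
  refine ⟨η / 3, by positivity, fun x hx d hd1 hd2 => ?_⟩
  have h := hmin (x, d) ⟨hx, abs_le.1 hd2, hd1⟩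
  simp only [hFdef] at h
  by_contra! hcon
  linarith [hcon.1, hcon.2.1, hcon.2.2]

lemma smoothing_le_of_forall {μ : Measure ℝ} [IsProbabilityMeasure μ] {n : ℕ} {x C : ℝ}
    (h : ∀ᵐ y ∂μ, cosKernel n (x - y) ≤ C) : smoothing μ n x ≤ C := by
  calc smoothing μ n x ≤ ∫ _, C ∂μ :=
        integral_mono_of_nonneg (Eventually.of_forall fun y => cosKernel_nonneg _ _)
          (integrable_const _) h
    _ = C := by simp

lemma smoothing_le_two_mul {μ : Measure ℝ} [IsProbabilityMeasure μ] {n : ℕ} (hn : 0 < n) (x : ℝ) :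
    smoothing μ n x ≤ 2 * n :=
  smoothing_le_of_forall (Eventually.of_forall fun y => (cosKernel_le hn _).trans
    (mul_le_of_le_one_right (by positivity)
      (pow_le_one₀ (sq_nonneg _) (Real.cos_sq_le_one _))))

lemma cos_pi_mul_sq_le {θ t : ℝ} (hθ : 0 ≤ θ) (h1 : θ ≤ |t|) (h2 : |t| ≤ 1 - θ) :
    Real.cos (Real.pi * t) ^ 2 ≤ Real.cos (Real.pi * θ) ^ 2 := by
  have hpi := Real.pi_pos
  have habs : Real.cos (Real.pi * t) = Real.cos (Real.pi * |t|) := by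
    rw [← Real.cos_abs, abs_mul, abs_of_pos hpi]
  rw [habs, sq_le_sq]
  have h3 : Real.cos (Real.pi * |t|) ≤ Real.cos (Real.pi * θ) :=
    Real.cos_le_cos_of_nonneg_of_le_pi (by positivity) (by nlinarith) (by gcongr)
  have h4 : -Real.cos (Real.pi * θ) ≤ Real.cos (Real.pi * |t|) := by
    rw [← Real.cos_pi_sub]
    exact Real.cos_le_cos_of_nonneg_of_le_pi (by positivity) (by nlinarith) (by nlinarith)
  exact (abs_le.2 ⟨h4, h3⟩).trans (le_abs_self _)

/-- If `E` has no progressions then the smoothings of a measure on `E` have few progressions. -/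
lemma eventually_progressionProduct_smoothing_le {E : Set ℝ} (hE : IsClosed E)
    (hE01 : E ⊆ Icc 0 1)
    (hno : ¬ ∃ x d : ℝ, d ≠ 0 ∧ x ∈ E ∧ x + d ∈ E ∧ x + 2 * d ∈ E)
    {μ : Measure ℝ} [IsProbabilityMeasure μ] (hμE : ∀ᵐ y ∂μ, y ∈ E) {ρ τ κ ε : ℝ}
    (hρ : 0 < ρ) (hρ1 : ρ ≤ 1) (hτ : 0 < τ) (hκ : 4 * κ ≤ ρ) (hε : 0 < ε) :
    ∀ᶠ n in atTop, ∀ x ∈ Icc ρ (1 - ρ), ∀ d : ℝ, τ ≤ |d| → |d| ≤ κ →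
      progressionProduct (smoothing μ n) d x ≤ ε := by
  obtain ⟨η, hη, hfar⟩ :=
    exists_le_infDist_of_no_progression hE hμE.exists hno ρ (1 - ρ) κ hτ
  set θ := min η (ρ / 2) with hθdef
  have hθ : 0 < θ := by positivity
  have hθη : θ ≤ η := min_le_left _ _
  have hθρ : θ ≤ ρ / 2 := min_le_right _ _
  set r := Real.cos (Real.pi * θ) ^ 2 with hr
  have hr0 : 0 ≤ r := sq_nonneg _
  have hr1 : r < 1 := by
    have hsin : 0 < Real.sin (Real.pi * θ) :=
      Real.sin_pos_of_pos_of_lt_pi (by positivity) (by nlinarith [Real.pi_pos])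
    nlinarith [Real.sin_sq_add_cos_sq (Real.pi * θ)]
  have hpt : ∀ n : ℕ, 0 < n → ∀ z ∈ Icc (ρ / 2) (1 - ρ / 2), η ≤ Metric.infDist z E →
      smoothing μ n z ≤ 2 * n * r ^ n := by
    intro n hn z hz hzE
    refine smoothing_le_of_forall (hμE.mono fun y hy => (cosKernel_le hn _).trans ?_)
    have h1 : θ ≤ |z - y| := hθη.trans (hzE.trans (Metric.infDist_le_dist_of_mem hy))
    have h2 : |z - y| ≤ 1 - θ := by
      have := hE01 hy
      rw [abs_le]; constructor <;> linarith [this.1, this.2, hz.1, hz.2]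
    gcongr
    exact cos_pi_mul_sq_le hθ.le h1 h2
  have hlim : Tendsto (fun n : ℕ => 8 * ((n : ℝ) ^ 3 * r ^ n)) atTop (nhds 0) := by
    have := (tendsto_pow_const_mul_const_pow_of_abs_lt_one 3
      (by rwa [abs_of_nonneg hr0] : |r| < 1)).const_mul (8 : ℝ)
    simpa using this
  filter_upwards [hlim.eventually (ge_mem_nhds hε), eventually_gt_atTop 0] with n hn hn0 x hx d
    hd1 hd2
  refine le_trans ?_ hn
  have hd := abs_le.1 hd2
  have hx0 : x ∈ Icc (ρ / 2) (1 - ρ / 2) := ⟨by linarith [hx.1], by linarith [hx.2]⟩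
  have hx1 : x + d ∈ Icc (ρ / 2) (1 - ρ / 2) :=
    ⟨by linarith [hx.1], by linarith [hx.2]⟩
  have hx2 : x + 2 * d ∈ Icc (ρ / 2) (1 - ρ / 2) :=
    ⟨by linarith [hx.1], by linarith [hx.2]⟩
  have hnn := smoothing_nonneg μ n
  have hub := smoothing_le_two_mul (μ := μ) hn0
  have h0 := hnn x; have h1 := hnn (x + d); have h2 := hnn (x + 2 * d)
  unfold progressionProduct
  rcases hfar x hx d hd1 hd2 with h | h | h
  · calc _ ≤ (2 * n * r ^ n) * (2 * n) * (2 * n) := by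
          gcongr
          exacts [hpt n hn0 _ hx0 h, hub _, hub _]
      _ = _ := by ring
  · calc _ ≤ (2 * n) * (2 * n * r ^ n) * (2 * n) := by
          gcongr
          exacts [hub _, hpt n hn0 _ hx1 h, hub _]
      _ = _ := by ring
  · calc _ ≤ (2 * n) * (2 * n) * (2 * n * r ^ n) := by
          gcongr
          exacts [hub _, hub _, hpt n hn0 _ hx2 h]
      _ = _ := by ring

/-- Super-polynomial decay absorbs the blow-up of the Fourier decay constant. -/
lemma exists_threshold (B X : ℝ) {s ε : ℝ} (hs : 0 < s) (hX : 0 ≤ X) (hε : 0 < ε) :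
    ∃ ε₀ : ℝ, 0 < ε₀ ∧ ε₀ ≤ 1 ∧ ∀ h : ℝ, 0 < h → h < ε₀ →
      X * ((h ^ (-B)) ^ 3 * ((⌊Real.exp (1 / h)⌋₊ ^ 2 : ℕ) : ℝ) ^ (-s)) < ε := by
  have hlim := (tendsto_rpow_mul_exp_neg_mul_atTop_nhds_zero (3 * B) (2 * s)
    (by positivity)).const_mul (X * 2 ^ (2 * s))
  rw [mul_zero] at hlim
  obtain ⟨y₀, hy₀⟩ := eventually_atTop.1 (hlim.eventually (gt_mem_nhds hε))
  refine ⟨1 / max y₀ 1, by positivity, div_le_one_of_le₀ (le_max_right _ _) (by positivity),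
    fun h h0 hlt => ?_⟩
  have hy : max y₀ 1 < 1 / h := by rwa [lt_one_div (by positivity) h0]
  have hexp : (2 : ℝ) ≤ Real.exp (1 / h) := by
    have := Real.add_one_le_exp (1 / h)
    linarith [le_max_right y₀ 1]
  have hfloor : Real.exp (1 / h) / 2 ≤ (⌊Real.exp (1 / h)⌋₊ : ℝ) := by
    linarith [Nat.lt_floor_add_one (Real.exp (1 / h))]
  have hpow : ((⌊Real.exp (1 / h)⌋₊ ^ 2 : ℕ) : ℝ) ^ (-s) ≤
      2 ^ (2 * s) * Real.exp (-(2 * s) * (1 / h)) := by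
    have hfp : (0 : ℝ) < ⌊Real.exp (1 / h)⌋₊ := by linarith
    rw [Nat.cast_pow, ← Real.rpow_natCast, ← Real.rpow_mul hfp.le]
    calc (⌊Real.exp (1 / h)⌋₊ : ℝ) ^ (((2 : ℕ) : ℝ) * -s)
        ≤ (Real.exp (1 / h) / 2) ^ (((2 : ℕ) : ℝ) * -s) :=
          Real.rpow_le_rpow_of_nonpos (by positivity) hfloor (by push_cast; linarith)
      _ = _ := by
          rw [Real.div_rpow (Real.exp_pos _).le zero_le_two, ← Real.exp_mul, div_eq_mul_inv,
            ← Real.rpow_neg zero_le_two, mul_comm]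
          push_cast
          congr 2 <;> ring
  have hB : (h ^ (-B)) ^ 3 = (1 / h) ^ (3 * B) := by
    rw [Real.rpow_neg h0.le, ← Real.inv_rpow h0.le, ← Real.rpow_natCast,
      ← Real.rpow_mul (by positivity), one_div]
    congr 1; push_cast; ring
  refine lt_of_le_of_lt ?_ (hy₀ (1 / h) ((le_max_left _ _).trans hy.le))
  rw [hB]
  calc _ ≤ X * ((1 / h) ^ (3 * B) * (2 ^ (2 * s) * Real.exp (-(2 * s) * (1 / h)))) := by gcongr
    _ = _ := by ring

/-- A bounded periodic density has many progressions away from the origin of the circle, with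
differences in a fixed annulus. -/
lemma exists_le_squareIntegral_progressionProduct {M : ℝ} (hM : 1 ≤ M) :
    ∃ ρ τ κ δ : ℝ, 0 < ρ ∧ ρ ≤ 1 ∧ 0 < τ ∧ 0 < κ ∧ 8 * κ ≤ ρ ∧ 0 < δ ∧
      ∀ f : ℝ → ℝ, Continuous f → Function.Periodic f 1 → (∀ x, 0 ≤ f x) → (∀ x, f x ≤ M) →
        ∫ x in (0 : ℝ)..1, f x = 1 →
        δ ≤ squareIntegral fun d x =>
          progressionProduct f d x * (farWeight ρ x * annulusWeight τ κ d) := by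
  have hM0 : 0 < M := by linarith
  obtain ⟨m, hm, hvar⟩ := exists_varnavides_bound hM0
  have hm1 : (1 : ℝ) ≤ m := by exact_mod_cast hm
  set ρ : ℝ := 1 / (16 * M) with hρdef
  set τ : ℝ := ρ / (16 * m) with hτdef
  have hρ : 0 < ρ := by positivity
  have hρM : ρ * M = 1 / 16 := by rw [hρdef]; field_simp
  have hρ16 : ρ ≤ 1 / 16 := by nlinarith
  have hτ : 0 < τ := by positivity
  have hτm : 2 * τ * m = ρ / 8 := by rw [hτdef]; field_simp; norm_num
  have hτρ : τ ≤ ρ / 16 := by nlinarith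
  refine ⟨ρ, τ, ρ / 8, τ / (64 * M * m ^ 2), hρ, by linarith, hτ, by positivity, by linarith,
    by positivity, fun f hf hper h0 hfM hmean => ?_⟩
  have hu : Continuous fun x : ℝ => farWeight ρ x := by fun_prop
  have hv : Continuous fun x : ℝ => annulusWeight τ (ρ / 8) x := by fun_prop
  have hu0 : ∀ x : ℝ, 0 ≤ farWeight ρ x := fun x => farWeight_nonneg ρ x
  have hu1 : ∀ x : ℝ, farWeight ρ x ≤ 1 := fun x => farWeight_le_one ρ x
  have hv0 : ∀ x : ℝ, 0 ≤ annulusWeight τ (ρ / 8) x := fun x => annulusWeight_nonneg _ _ x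
  have hmass : 3 / 4 ≤ ∫ x in (0 : ℝ)..1, f x * farWeight ρ x := by
    have hfar := le_integral_farWeight hρ (by linarith)
    calc (3 / 4 : ℝ) ≤ 1 - M * (1 - ∫ x in (0 : ℝ)..1, farWeight ρ x) := by nlinarith
      _ = ∫ x in (0 : ℝ)..1, (f x - M * (1 - farWeight ρ x)) := by
          rw [intervalIntegral.integral_sub (hf.intervalIntegrable _ _)
            (Continuous.intervalIntegrable (by fun_prop) _ _), hmean,
            intervalIntegral.integral_const_mul,
            intervalIntegral.integral_sub (by simp) (hu.intervalIntegrable _ _)]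
          simp
      _ ≤ _ := intervalIntegral.integral_mono_on zero_le_one
          (Continuous.intervalIntegrable (by fun_prop) _ _)
          (Continuous.intervalIntegrable (by fun_prop) _ _)
          fun x _ => by nlinarith [hfM x, hu1 x]
  have hmain := hvar τ hτ (by linarith) (fun d => annulusWeight τ (ρ / 8) d) hv hv0
    (fun d hd1 hd2 => annulusWeight_eq_one hτ (by positivity)
      (le_unitAddCircle_norm hd1 (by linarith) ⟨by linarith, by linarith⟩)
      (by
        have := unitAddCircle_norm_le_abs_sub_intCast d 0
        rw [Int.cast_zero, sub_zero, abs_of_nonneg (by linarith)] at this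
        linarith))
    (fun x => f x * farWeight ρ x) (by fun_prop)
    (fun x => by
      have : ((x + 1 : ℝ) : UnitAddCircle) = x := AddCircle.coe_add_period 1 x
      simp only [hper x, this])
    (fun x => mul_nonneg (h0 x) (hu0 x))
    (fun x => (mul_le_of_le_one_right (h0 x) (hu1 x)).trans (hfM x)) hmass
  refine hmain.trans ?_
  simp only [← intervalIntegral.integral_const_mul]
  refine squareIntegral_mono (by unfold Function.uncurry; fun_prop)
    (by unfold Function.uncurry progressionProduct; fun_prop) fun d _ x _ => ?_
  have hp : 0 ≤ progressionProduct f d x := mul_nonneg (mul_nonneg (h0 _) (h0 _)) (h0 _)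
  have hprod : farWeight ρ (x + d : ℝ) * farWeight ρ (x + 2 * d : ℝ) ≤ 1 :=
    mul_le_one₀ (hu1 _) (hu0 _) (hu1 _)
  calc _ = progressionProduct f d x * (farWeight ρ x * annulusWeight τ (ρ / 8) d) *
        (farWeight ρ (x + d : ℝ) * farWeight ρ (x + 2 * d : ℝ)) := by
        unfold progressionProduct; ring
    _ ≤ _ := mul_le_of_le_one_right (mul_nonneg hp (mul_nonneg (hu0 x) (hv0 d))) hprod

/-- The weighted count of progressions in the smoothings of a measure on a progression-free set
tends to zero. -/
lemma eventually_squareIntegral_smoothing_le {E : Set ℝ} (hE : IsClosed E)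
    (hE01 : E ⊆ Icc 0 1)
    (hno : ¬ ∃ x d : ℝ, d ≠ 0 ∧ x ∈ E ∧ x + d ∈ E ∧ x + 2 * d ∈ E)
    {μ : Measure ℝ} [IsProbabilityMeasure μ] (hμE : ∀ᵐ y ∂μ, y ∈ E) {ρ τ κ ε : ℝ}
    (hρ : 0 < ρ) (hρ1 : ρ ≤ 1) (hτ : 0 < τ) (hκ0 : 0 < κ) (hκ : 8 * κ ≤ ρ) (hε : 0 < ε) :
    ∀ᶠ n in atTop, squareIntegral (fun d x => progressionProduct (smoothing μ n) d x *
      (farWeight ρ x * annulusWeight τ κ d)) ≤ ε := by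
  filter_upwards [eventually_progressionProduct_smoothing_le hE hE01 hno hμE hρ hρ1 (half_pos hτ)
    (by linarith : 4 * (2 * κ) ≤ ρ) hε] with n hn
  rw [← squareIntegral_const ε]
  refine squareIntegral_mono (by unfold Function.uncurry progressionProduct; fun_prop)
    (by unfold Function.uncurry; fun_prop) fun d _ x hx => ?_
  have hp : 0 ≤ progressionProduct (smoothing μ n) d x :=
    mul_nonneg (mul_nonneg (smoothing_nonneg ..) (smoothing_nonneg ..)) (smoothing_nonneg ..)
  rcases (farWeight_nonneg ρ x).eq_or_lt with hu | hu
  · simpa [← hu] using hε.le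
  rcases (annulusWeight_nonneg τ κ d).eq_or_lt with hv | hv
  · simpa [← hv] using hε.le
  have hxρ := le_norm_of_farWeight_pos hρ hu
  have hx0 := hxρ.trans (unitAddCircle_norm_le_abs_sub_intCast x 0)
  have hx1 := hxρ.trans (unitAddCircle_norm_le_abs_sub_intCast x 1)
  rw [Int.cast_zero, sub_zero, abs_of_nonneg hx.1] at hx0
  rw [Int.cast_one, abs_of_nonpos (by linarith [hx.2])] at hx1
  have hd := norm_mem_of_annulusWeight_pos hτ hκ0 hv
  rw [UnitAddCircle.norm_eq] at hd
  have hshift : progressionProduct (smoothing μ n) (d - round d) x =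
      progressionProduct (smoothing μ n) d x := by
    have h1 := sub_intCast_eq_of_periodic_one (smoothing_periodic μ n) (round d) (x + d)
    have h2 := sub_intCast_eq_of_periodic_one (smoothing_periodic μ n) (2 * round d) (x + 2 * d)
    push_cast at h2
    unfold progressionProduct
    rw [← h1, ← h2]
    ring_nf
  have hle := hn x ⟨hx0, by linarith⟩ (d - round d) hd.1 hd.2
  rw [hshift] at hle
  exact (mul_le_of_le_one_right hp (mul_le_one₀ (farWeight_le_one ρ x)
    (annulusWeight_nonneg τ κ d) (annulusWeight_le_one τ κ d))).trans hle

lemma floor_exp_rpow_le {h : ℝ} (h0 : 0 < h) : (⌊Real.exp (1 / h)⌋₊ : ℝ) ^ h ≤ Real.exp 1 := by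
  calc (⌊Real.exp (1 / h)⌋₊ : ℝ) ^ h ≤ Real.exp (1 / h) ^ h := by
        gcongr; exact Nat.floor_le (Real.exp_pos _).le
    _ = Real.exp 1 := by rw [← Real.exp_mul, one_div_mul_cancel h0.ne']

/-- Łaba–Pramanik: for every `C1, C2, B > 0` and `2/3 < β ≤ 1` there is `ε0 > 0`
(depending only on these constants) such that any closed `E ⊆ [0,1]` supporting a
probability measure with ball condition of exponent `α ∈ (1 − ε0, 1)` and Fourier decay
`|μ̂(k)| ≤ C2 (1−α)^{−B} |k|^{−β/2}` contains a non-trivial 3-term arithmetic progression. -/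
theorem statement0 (C1 C2 B : ℝ) (hC1 : 0 < C1) (hC2 : 0 < C2) (hB : 0 < B)
    (β : ℝ) (hβ : 2 / 3 < β) (hβ1 : β ≤ 1) :
    ∃ ε0 : ℝ, 0 < ε0 ∧
      ∀ α : ℝ, 1 - ε0 < α → α < 1 →
      ∀ E : Set ℝ, IsClosed E → E ⊆ Set.Icc 0 1 →
      ∀ μ : MeasureTheory.Measure ℝ, MeasureTheory.IsProbabilityMeasure μ → μ Eᶜ = 0 →
      (∀ x : ℝ, ∀ ε : ℝ, 0 < ε → ε ≤ 1 →
        (μ (Set.Icc x (x + ε))).toReal ≤ C1 * ε ^ α) →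
      (∀ k : ℤ, k ≠ 0 →
        ‖ftransform μ (k : ℝ)‖ ≤ C2 * (1 - α) ^ (-B) * |(k : ℝ)| ^ (-(β / 2))) →
      ∃ x d : ℝ, d ≠ 0 ∧ x ∈ E ∧ x + d ∈ E ∧ x + 2 * d ∈ E := by
  set M : ℝ := 24 * C1 * Real.exp 1 + 1 with hMdef
  have hM1 : 1 ≤ M := by rw [hMdef]; linarith [show 0 < 24 * C1 * Real.exp 1 by positivity]
  have hM0 : 0 < M := by linarith
  obtain ⟨ρ, τ, κ, δ, hρ, hρ1, hτ, hκ0, hκ, hδ, hlower⟩ :=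
    exists_le_squareIntegral_progressionProduct hM1
  obtain ⟨T, c, hTc⟩ := exists_trig_minorant (farWeight ρ) (annulusWeight τ κ)
    (show 0 < δ / (4 * M ^ 3) by positivity)
  set Q : ℝ → ℝ → ℂ := fun d x => ∑ t ∈ T, c t * (echar (t 0) x * echar (t 1) d) with hQ
  have hQc : Continuous (Function.uncurry Q) := by
    rw [hQ]; unfold Function.uncurry; fun_prop
  have hQre : Continuous (Function.uncurry fun d x => (Q d x).re) :=
    Complex.continuous_re.comp hQc
  set s : ℝ := (β - 2 / 3) / 8 with hs_def
  set γ : ℝ := β / 4 + 1 / 6 with hγ_def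
  have hs : 0 < s := by rw [hs_def]; linarith
  have hs1 : s ≤ 1 := by rw [hs_def]; linarith
  have hγ : 1 / 3 < γ := by rw [hγ_def]; linarith
  have hγs : γ + 2 * s = β / 2 := by rw [hs_def, hγ_def]; ring
  set W := ∑ t ∈ T, ‖c t‖ with hW
  set Z := ∑' k, decay γ k ^ 3 with hZ
  have hW0 : 0 ≤ W := Finset.sum_nonneg fun _ _ => norm_nonneg _
  have hZ0 : 0 ≤ Z := tsum_nonneg fun k => pow_nonneg (decay_nonneg γ k) 3
  obtain ⟨ε0, hε0, hε01, hthr⟩ := exists_threshold B (W * 3 * (1 + C2) ^ 3 * Z) hs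
    (by positivity) (show 0 < δ / 4 by positivity)
  refine ⟨ε0, hε0, fun α hα hα1 E hE hE01 μ hμ hμE hball hdecay => ?_⟩
  by_contra hno
  have hae : ∀ᵐ y ∂μ, y ∈ E := hμE
  have hh : 0 < 1 - α := by linarith
  set L : ℕ := ⌊Real.exp (1 / (1 - α))⌋₊ with hL
  have hL0 : 0 < L := Nat.floor_pos.2 (Real.one_le_exp (by positivity))
  have hfM : ∀ x, smoothing μ (L ^ 2) x ≤ M := fun x => by
    calc smoothing μ (L ^ 2) x ≤ 24 * C1 * (L : ℝ) ^ (1 - α) :=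
          smoothing_sq_le (hae.mono fun y hy => hE01 hy) hball hC1 hL0 x
      _ ≤ 24 * C1 * Real.exp 1 := by gcongr; exact floor_exp_rpow_le hh
      _ ≤ M := by linarith
  have hPc : ∀ n, Continuous (Function.uncurry (progressionProduct (smoothing μ n))) := fun n => by
    unfold Function.uncurry progressionProduct; fun_prop
  have hP0 : ∀ n d x, 0 ≤ progressionProduct (smoothing μ n) d x := fun n d x =>
    mul_nonneg (mul_nonneg (smoothing_nonneg ..) (smoothing_nonneg ..)) (smoothing_nonneg ..)
  have hPM : ∀ d x, progressionProduct (smoothing μ (L ^ 2)) d x ≤ M ^ 3 := fun d x => by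
    have h0 := smoothing_nonneg μ (L ^ 2)
    calc _ ≤ M * M * M := by
          unfold progressionProduct
          exact mul_le_mul (mul_le_mul (hfM _) (hfM _) (h0 _) hM0.le) (hfM _) (h0 _) (by positivity)
      _ = _ := by ring
  have hPQc : ∀ n, Continuous (Function.uncurry fun d x =>
      progressionProduct (smoothing μ n) d x * (Q d x).re) := fun n => (hPc n).mul hQre
  have hPuv : ∀ n, Continuous (Function.uncurry fun d x =>
      progressionProduct (smoothing μ n) d x * (farWeight ρ x * annulusWeight τ κ d)) := fun n => by
    unfold Function.uncurry progressionProduct; fun_prop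
  have hlow : δ / 2 ≤ squareIntegral fun d x =>
      progressionProduct (smoothing μ (L ^ 2)) d x * (Q d x).re := by
    have h1 := hlower _ (continuous_smoothing μ (L ^ 2)) (smoothing_periodic μ _)
      (smoothing_nonneg μ _) hfM (integral_smoothing μ _)
    have h2 := squareIntegral_mono (hPuv (L ^ 2)) (G := fun d x =>
      progressionProduct (smoothing μ (L ^ 2)) d x * (Q d x).re + δ / 2)
      ((hPQc (L ^ 2)).add continuous_const) fun d _ x _ => by
        have hle := mul_le_mul_of_nonneg_left (hTc x d).1 (hP0 (L ^ 2) d x)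
        have herr : progressionProduct (smoothing μ (L ^ 2)) d x * (2 * (δ / (4 * M ^ 3))) ≤
            δ / 2 := by
          calc _ ≤ M ^ 3 * (2 * (δ / (4 * M ^ 3))) := by gcongr; exact hPM d x
            _ = _ := by field_simp; norm_num
        simp only [hQ]
        linarith
    rw [squareIntegral_add (hPQc _) continuous_const, squareIntegral_const] at h2
    linarith
  obtain ⟨n, hn, hnN⟩ := ((eventually_squareIntegral_smoothing_le hE hE01 hno hae hρ hρ1 hτ hκ0 hκ
    (show 0 < δ / 8 by positivity)).and (eventually_ge_atTop (L ^ 2))).exists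
  have hup : squareIntegral (fun d x => progressionProduct (smoothing μ n) d x * (Q d x).re) ≤
      δ / 8 :=
    (squareIntegral_mono (hPQc n) (hPuv n) fun d _ x _ =>
      mul_le_mul_of_nonneg_left (hTc x d).2 (hP0 n d x)).trans hn
  have hD : 1 ≤ (1 + C2) * (1 - α) ^ (-B) := by
    have := Real.one_le_rpow_of_pos_of_le_one_of_nonpos hh (by linarith : 1 - α ≤ 1)
      (by linarith : -B ≤ 0)
    nlinarith
  have hdiff := norm_squareIntegral_progressionProduct_sub_le hD hs hs1 hγ (fun k hk =>
    (hdecay k hk).trans (by rw [hγs]; gcongr; linarith)) (pow_pos hL0 2) hnN T c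
  have hcont : Continuous (Function.uncurry fun d x => ∑ t ∈ T, c t *
      (((progressionProduct (smoothing μ n) d x - progressionProduct (smoothing μ (L ^ 2)) d x :
        ℝ) : ℂ) * (echar (t 0) x * echar (t 1) d))) := by
    unfold Function.uncurry progressionProduct; fun_prop
  have hre := (Complex.abs_re_le_norm _).trans hdiff
  rw [re_squareIntegral hcont] at hre
  have hsplit : (squareIntegral fun d x =>
      progressionProduct (smoothing μ n) d x * (Q d x).re) =
      squareIntegral (fun d x => (∑ t ∈ T, c t *
        (((progressionProduct (smoothing μ n) d x -
          progressionProduct (smoothing μ (L ^ 2)) d x : ℝ) : ℂ) *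
          (echar (t 0) x * echar (t 1) d))).re) +
      squareIntegral fun d x =>
        progressionProduct (smoothing μ (L ^ 2)) d x * (Q d x).re := by
    rw [← squareIntegral_add ?_ (hPQc _)]
    · congr 1
      ext d x
      simp only [mul_left_comm (c _), ← Finset.mul_sum, Complex.re_ofReal_mul, hQ]
      ring
    · exact Complex.continuous_re.comp hcont
  have hsmall := hthr (1 - α) hh (by linarith)
  rw [← hL] at hsmall
  have hbound : W * (3 * (((1 + C2) * (1 - α) ^ (-B)) ^ 3 * ((L ^ 2 : ℕ) : ℝ) ^ (-s) * Z)) =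
      W * 3 * (1 + C2) ^ 3 * Z * (((1 - α) ^ (-B)) ^ 3 * ((L ^ 2 : ℕ) : ℝ) ^ (-s)) := by ring
  rw [hbound] at hre
  linarith [(abs_le.1 hre).1]
end

section
/- With the above construction, the Fourier–Stieltjes transform of the limit measure μ admits the product representation μ̂(u) = lim_{m→∞} Q^{(1)}(u) · ∏_{k=1}^{m} Q^{(k+1)}(η_1·η_2⋯η_k·u) for every u ∈ ℝ, where Q^{(k)}(u) = (1/d_k) Σ_{a ∈ A_k} e^{−2πi·u·a/M_k}. -/
open MeasureTheory Filter Set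
open scoped BigOperators ENNReal

/-- Number of elements of `A ⊆ ℕ` below `n`, i.e. `|A ∩ [0, n)|`. -/
noncomputable def cardBelow (A : Set ℕ) (n : ℕ) : ℕ := Nat.card ↥(A ∩ Set.Iio n)

/-- `A ⊆ ℕ` has upper fractional density `α`: `limsup_N |A ∩ [0,N)| / N^b` is `∞` for
every `b < α` and `0` for every `b > α`. -/
def HasUpperFracDensity (A : Set ℕ) (α : ℝ) : Prop :=
  (∀ b : ℝ, b < α →
    Filter.atTop.limsup (fun n : ℕ => (cardBelow A n : ℝ≥0∞) / (n : ℝ≥0∞) ^ b) = ⊤) ∧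
  (∀ b : ℝ, α < b →
    Filter.atTop.limsup (fun n : ℕ => (cardBelow A n : ℝ≥0∞) / (n : ℝ≥0∞) ^ b) = 0)

/-- `η_k = 1 − 1/(k+1)²`. -/
noncomputable def etaseq (k : ℕ) : ℝ := 1 - 1 / ((k : ℝ) + 1) ^ 2

/-- The common length `L_k = (η_1 ⋯ η_k)/(N_1 ⋯ N_k)` of the intervals making up the
`k`-th stage `B_k` of the construction (`L_0 = 1`). -/
noncomputable def Lfun (N : ℕ → ℕ) : ℕ → ℝ
  | 0 => 1
  | k + 1 => etaseq (k + 1) * Lfun N k / (N (k + 1) : ℝ)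

/-- The set of left endpoints of the intervals making up the `k`-th stage `B_k`:
at stage `k+1` each interval of `B_k` is divided into `N_{k+1}` equal subintervals and,
for each `a ∈ A ∩ [0, N_{k+1})`, the left-hand portion of the `a`-th subinterval is kept. -/
def leftEnds (A : Set ℕ) (N : ℕ → ℕ) : ℕ → Set ℝ
  | 0 => {0}
  | k + 1 => {y : ℝ | ∃ x ∈ leftEnds A N k, ∃ a : ℕ, a ∈ A ∧ a < N (k + 1) ∧
      y = x + (a : ℝ) * Lfun N k / (N (k + 1) : ℝ)}

/-- The `k`-th stage `B_k` of the construction: the union of the closed intervals of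
length `L_k` with left endpoints in `leftEnds A N k`. -/
def Bset (A : Set ℕ) (N : ℕ → ℕ) (k : ℕ) : Set ℝ :=
  ⋃ x ∈ leftEnds A N k, Set.Icc x (x + Lfun N k)

/-- The limit set `B = ⋂_k B_k` of the construction. -/
def Blim (A : Set ℕ) (N : ℕ → ℕ) : Set ℝ := ⋂ k, Bset A N k


/-- `M_k = N_1 N_2 ⋯ N_k`. -/
noncomputable def Mprod (N : ℕ → ℕ) (k : ℕ) : ℕ := ∏ j ∈ Finset.Icc 1 k, N j

open Classical in
/-- The exponential sum `Q^{(k)}(u) = (1/d_k) Σ_{a ∈ A ∩ [0,N_k)} e^{−2πi u a / M_k}`. -/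
noncomputable def Qsum (A : Set ℕ) (N : ℕ → ℕ) (k : ℕ) (u : ℝ) : ℂ :=
  (cardBelow A (N k) : ℂ)⁻¹ * ∑ a ∈ Finset.range (N k),
    (if a ∈ A then
      Complex.exp ((-2) * (Real.pi : ℂ) * Complex.I * (u : ℂ) * (a : ℂ) / (Mprod N k : ℂ))
     else 0)

/-- `D_k = d_1 d_2 ⋯ d_k` where `d_j = |A ∩ [0,N_j)|`. -/
noncomputable def Dprod (A : Set ℕ) (N : ℕ → ℕ) (k : ℕ) : ℕ :=
  ∏ j ∈ Finset.Icc 1 k, cardBelow A (N j)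

/-- The probability measure `μ_k` on `[0,1]` whose distribution function `F_k` vanishes
at `0`, increases linearly by `1/(d_1⋯d_k)` across each of the `d_1⋯d_k` intervals of
length `L_k` composing `B_k`, and is constant off `B_k`; equivalently, the normalised
restriction of Lebesgue measure to `B_k`. -/
noncomputable def muk (A : Set ℕ) (N : ℕ → ℕ) (k : ℕ) : MeasureTheory.Measure ℝ :=
  (ENNReal.ofReal ((Dprod A N k : ℝ) * Lfun N k))⁻¹ •
    MeasureTheory.volume.restrict (Bset A N k)

/-- `η_1 η_2 ⋯ η_k`. -/
noncomputable def etaProd (k : ℕ) : ℝ := ∏ j ∈ Finset.Icc 1 k, etaseq j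

theorem etaseq_pos {k : ℕ} (hk : 1 ≤ k) : 0 < etaseq k := by
  have h : (1 : ℝ) ≤ k := by exact_mod_cast hk
  rw [etaseq, sub_pos, div_lt_one (by positivity)]
  nlinarith

theorem etaseq_lt_one (k : ℕ) : etaseq k < 1 := by
  rw [etaseq]
  have : (0 : ℝ) < 1 / ((k : ℝ) + 1) ^ 2 := by positivity
  linarith

theorem Lfun_pos {N : ℕ → ℕ} (hN : ∀ k, 0 < N (k + 1)) (k : ℕ) : 0 < Lfun N k := by
  induction k with
  | zero => simp [Lfun]
  | succ k ih =>
    have h1 := etaseq_pos (Nat.le_add_left 1 k)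
    have h2 : (0 : ℝ) < N (k + 1) := by exact_mod_cast hN k
    rw [Lfun]
    positivity

theorem Lfun_succ_lt {N : ℕ → ℕ} (hN : ∀ k, 0 < N (k + 1)) (k : ℕ) :
    Lfun N (k + 1) < Lfun N k / N (k + 1) := by
  have h2 : (0 : ℝ) < N (k + 1) := by exact_mod_cast hN k
  rw [Lfun]
  gcongr
  exact mul_lt_of_lt_one_left (Lfun_pos hN k) (etaseq_lt_one _)

theorem Lfun_le_one {N : ℕ → ℕ} (hN : ∀ k, 0 < N (k + 1)) (k : ℕ) : Lfun N k ≤ 1 := by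
  induction k with
  | zero => simp [Lfun]
  | succ k ih =>
    have h2 : (1 : ℝ) ≤ N (k + 1) := by exact_mod_cast hN k
    exact (Lfun_succ_lt hN k).le.trans ((div_le_self (Lfun_pos hN k).le h2).trans ih)

theorem tendsto_Lfun {N : ℕ → ℕ} (hN : StrictMono N) :
    Tendsto (Lfun N) atTop (nhds 0) := by
  have hpos : ∀ k, 0 < N (k + 1) := fun k => k.succ_pos.trans_le (hN.id_le _)
  rw [← tendsto_add_atTop_iff_nat 1]
  refine squeeze_zero (fun k => (Lfun_pos hpos _).le) (fun k => ?_)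
    (tendsto_one_div_add_atTop_nhds_zero_nat (𝕜 := ℝ))
  refine (Lfun_succ_lt hpos k).le.trans ?_
  have h : (k : ℝ) + 1 ≤ N (k + 1) := by exact_mod_cast hN.id_le (k + 1)
  exact div_le_div₀ zero_le_one (Lfun_le_one hpos k) (by positivity) h

theorem Lfun_eq_etaProd_div (N : ℕ → ℕ) (k : ℕ) : Lfun N k = etaProd k / Mprod N k := by
  induction k with
  | zero => simp [Lfun, etaProd, Mprod]
  | succ k ih =>
    rw [Lfun, ih, etaProd, etaProd, Mprod, Mprod, Finset.prod_Icc_succ_top (by omega),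
      Finset.prod_Icc_succ_top (by omega)]
    push_cast
    rw [mul_div_assoc', div_div, mul_comm (etaseq _)]

open Classical in
/-- `leftEnds A N k` as a finset. -/
noncomputable def leftFinset (A : Set ℕ) (N : ℕ → ℕ) : ℕ → Finset ℝ
  | 0 => {0}
  | k + 1 => (leftFinset A N k ×ˢ (Finset.range (N (k + 1))).filter (· ∈ A)).image
      fun p => p.1 + (p.2 : ℝ) * Lfun N k / (N (k + 1) : ℝ)

theorem mem_leftFinset {A : Set ℕ} {N : ℕ → ℕ} {k : ℕ} {y : ℝ} :
    y ∈ leftFinset A N k ↔ y ∈ leftEnds A N k := by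
  induction k generalizing y with
  | zero => simp [leftFinset, leftEnds]
  | succ k ih =>
    simp only [leftFinset, leftEnds, Finset.mem_image, Finset.mem_product, Finset.mem_filter,
      Finset.mem_range, Set.mem_ofPred_eq, Prod.exists, ih]
    grind

theorem Bset_eq_biUnion_leftFinset (A : Set ℕ) (N : ℕ → ℕ) (k : ℕ) :
    Bset A N k = ⋃ x ∈ leftFinset A N k, Set.Icc x (x + Lfun N k) := by
  simp only [Bset, mem_leftFinset]

/-- Children of ordered, separated parent intervals are ordered and separated. -/
theorem child_add_Lfun_lt {N : ℕ → ℕ} (hN : ∀ k, 0 < N (k + 1)) {k a a' : ℕ} {x x' : ℝ}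
    (ha : a < N (k + 1)) (h : x + Lfun N k < x' ∨ x = x' ∧ a < a') :
    x + a * Lfun N k / N (k + 1) + Lfun N (k + 1) < x' + a' * Lfun N k / N (k + 1) := by
  have hN0 : (0 : ℝ) < N (k + 1) := by exact_mod_cast hN k
  have hd : 0 < Lfun N k / N (k + 1) := div_pos (Lfun_pos hN k) hN0
  have hlt := Lfun_succ_lt hN k
  rw [mul_div_assoc, mul_div_assoc]
  rcases h with h | ⟨rfl, h⟩
  · have h1 : ((a : ℝ) + 1) * (Lfun N k / N (k + 1)) ≤ N (k + 1) * (Lfun N k / N (k + 1)) := by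
      gcongr
      exact_mod_cast ha
    rw [mul_div_cancel₀ _ hN0.ne'] at h1
    have h2 : 0 ≤ (a' : ℝ) * (Lfun N k / N (k + 1)) := by positivity
    linarith
  · have h1 : ((a : ℝ) + 1) * (Lfun N k / N (k + 1)) ≤ a' * (Lfun N k / N (k + 1)) := by
      gcongr
      exact_mod_cast h
    linarith

theorem add_Lfun_lt_of_mem_leftEnds {A : Set ℕ} {N : ℕ → ℕ} (hN : ∀ k, 0 < N (k + 1)) {k : ℕ} :
    ∀ {x y : ℝ}, x ∈ leftEnds A N k → y ∈ leftEnds A N k → x < y → x + Lfun N k < y := by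
  induction k with
  | zero =>
    rintro x y rfl rfl h
    exact absurd h (lt_irrefl _)
  | succ k ih =>
    rintro _ _ ⟨x, hx, a, -, ha, rfl⟩ ⟨x', hx', a', -, ha', rfl⟩ h
    refine child_add_Lfun_lt hN ha ?_
    by_contra! hcon
    have hL := Lfun_pos hN (k + 1)
    rcases lt_trichotomy x x' with hlt | rfl | hlt
    · exact (ih hx hx' hlt).not_ge hcon.1
    · rcases (hcon.2 rfl).eq_or_lt with rfl | h'
      · exact lt_irrefl _ h
      · linarith [child_add_Lfun_lt hN ha' (x := x) (Or.inr ⟨rfl, h'⟩)]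
    · linarith [child_add_Lfun_lt hN ha' (a' := a) (Or.inl (ih hx' hx hlt))]

open Classical in
theorem sum_leftFinset_succ {A : Set ℕ} {N : ℕ → ℕ} (hN : ∀ k, 0 < N (k + 1)) (k : ℕ)
    (f : ℝ → ℂ) :
    ∑ y ∈ leftFinset A N (k + 1), f y = ∑ x ∈ leftFinset A N k,
      ∑ a ∈ Finset.range (N (k + 1)) with a ∈ A, f (x + a * Lfun N k / N (k + 1)) := by
  rw [leftFinset, Finset.sum_image, Finset.sum_product]
  rintro ⟨x, a⟩ hp ⟨x', a'⟩ hp' h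
  simp only [Finset.coe_product, Set.mem_prod, Finset.mem_coe, mem_leftFinset, Finset.mem_filter,
    Finset.mem_range] at hp hp' h
  have hL := Lfun_pos hN (k + 1)
  rcases lt_trichotomy x x' with hlt | rfl | hlt
  · linarith [child_add_Lfun_lt hN hp.2.1 (a' := a')
      (Or.inl (add_Lfun_lt_of_mem_leftEnds hN hp.1 hp'.1 hlt))]
  · rcases lt_trichotomy a a' with hlt | rfl | hlt
    · linarith [child_add_Lfun_lt hN hp.2.1 (x := x) (Or.inr ⟨rfl, hlt⟩)]
    · rfl
    · linarith [child_add_Lfun_lt hN hp'.2.1 (x := x) (Or.inr ⟨rfl, hlt⟩)]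
  · linarith [child_add_Lfun_lt hN hp'.2.1 (a' := a)
      (Or.inl (add_Lfun_lt_of_mem_leftEnds hN hp'.1 hp.1 hlt))]

theorem inv_Dprod_mul_sum_exp {A : Set ℕ} {N : ℕ → ℕ} (hN : ∀ k, 0 < N (k + 1)) (u : ℝ)
    (k : ℕ) :
    (Dprod A N k : ℂ)⁻¹ * ∑ x ∈ leftFinset A N k,
        Complex.exp ((-2) * (Real.pi : ℂ) * Complex.I * (u : ℂ) * (x : ℂ)) =
      ∏ j ∈ Finset.range k, Qsum A N (j + 1) (etaProd j * u) := by
  classical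
  induction k with
  | zero => simp [leftFinset, Dprod]
  | succ k ih =>
    have hQ : Qsum A N (k + 1) (etaProd k * u) = (cardBelow A (N (k + 1)) : ℂ)⁻¹ *
        ∑ a ∈ Finset.range (N (k + 1)) with a ∈ A, Complex.exp ((-2) * (Real.pi : ℂ) * Complex.I *
          (u : ℂ) * ((a * Lfun N k / N (k + 1) : ℝ) : ℂ)) := by
      rw [Qsum, Finset.sum_filter]
      congr 1
      refine Finset.sum_congr rfl fun a _ => ?_
      congr 2
      rw [Lfun_eq_etaProd_div, Mprod, Mprod, Finset.prod_Icc_succ_top (by omega)]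
      push_cast
      simp only [div_eq_mul_inv, mul_inv]
      ring
    have hD : Dprod A N (k + 1) = Dprod A N k * cardBelow A (N (k + 1)) := by
      rw [Dprod, Dprod, Finset.prod_Icc_succ_top (by omega)]
    rw [Finset.prod_range_succ, ← ih, hQ, hD, sum_leftFinset_succ hN]
    simp only [Complex.ofReal_add, mul_add, Complex.exp_add, ← Finset.mul_sum, ← Finset.sum_mul]
    push_cast
    rw [mul_inv]
    ring

theorem continuous_exp_char (u : ℝ) : Continuous fun x : ℝ =>
    Complex.exp ((-2) * (Real.pi : ℂ) * Complex.I * (u : ℂ) * (x : ℂ)) := by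
  fun_prop

theorem setIntegral_exp_Icc (u x : ℝ) {L : ℝ} (hL : 0 ≤ L) :
    ∫ t in Set.Icc x (x + L), Complex.exp ((-2) * (Real.pi : ℂ) * Complex.I * (u : ℂ) * (t : ℂ)) =
      Complex.exp ((-2) * (Real.pi : ℂ) * Complex.I * (u : ℂ) * (x : ℂ)) *
        ∫ t in (0 : ℝ)..L, Complex.exp ((-2) * (Real.pi : ℂ) * Complex.I * (u : ℂ) * (t : ℂ)) := by
  rw [integral_Icc_eq_integral_Ioc, ← intervalIntegral.integral_of_le (by linarith),
    ← intervalIntegral.integral_const_mul]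
  simp only [← Complex.exp_add, ← mul_add, ← Complex.ofReal_add]
  rw [intervalIntegral.integral_comp_add_left (fun t : ℝ =>
    Complex.exp ((-2) * (Real.pi : ℂ) * Complex.I * (u : ℂ) * (t : ℂ))), add_zero]

theorem ftransform_muk {A : Set ℕ} {N : ℕ → ℕ} (hN : ∀ k, 0 < N (k + 1)) (k : ℕ) (u : ℝ) :
    ftransform (muk A N k) u =
      (∏ j ∈ Finset.range k, Qsum A N (j + 1) (etaProd j * u)) *
        ((Lfun N k)⁻¹ • ∫ t in (0 : ℝ)..Lfun N k,
          Complex.exp ((-2) * (Real.pi : ℂ) * Complex.I * (u : ℂ) * (t : ℂ))) := by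
  have hL := Lfun_pos hN k
  rw [ftransform, muk, integral_smul_measure, ENNReal.toReal_inv,
    ENNReal.toReal_ofReal (by positivity), Bset_eq_biUnion_leftFinset, integral_biUnion_finset]
  · simp only [setIntegral_exp_Icc u _ hL.le]
    rw [← Finset.sum_mul, ← inv_Dprod_mul_sum_exp hN, Complex.real_smul, Complex.real_smul]
    push_cast
    rw [mul_inv]
    ring
  · exact fun _ _ => measurableSet_Icc
  · intro x hx y hy hxy
    rw [Finset.mem_coe, mem_leftFinset] at hx hy
    rw [Function.onFun, Set.disjoint_left]
    rintro t ⟨h1, h2⟩ ⟨h3, h4⟩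
    rcases hxy.lt_or_gt with h | h
    · linarith [add_Lfun_lt_of_mem_leftEnds hN hx hy h]
    · linarith [add_Lfun_lt_of_mem_leftEnds hN hy hx h]
  · exact fun _ _ => (continuous_exp_char u).integrableOn_Icc

theorem integrable_exp_muk {A : Set ℕ} {N : ℕ → ℕ} (hN : ∀ k, 0 < N (k + 1))
    (hA : ∀ k, 0 < cardBelow A (N (k + 1))) (k : ℕ) (u : ℝ) :
    Integrable (fun x : ℝ => Complex.exp ((-2) * (Real.pi : ℂ) * Complex.I * (u : ℂ) * (x : ℂ)))
      (muk A N k) := by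
  have hL := Lfun_pos hN k
  have hD : 0 < Dprod A N k := by
    refine Finset.prod_pos fun j hj => ?_
    obtain ⟨i, rfl⟩ := Nat.exists_eq_add_of_le' (Finset.mem_Icc.1 hj).1
    exact hA i
  refine Integrable.smul_measure ?_ (ENNReal.inv_ne_top.2 ?_)
  · rw [Bset_eq_biUnion_leftFinset]
    exact integrableOn_finset_iUnion.2 fun _ _ => (continuous_exp_char u).integrableOn_Icc
  · rw [ENNReal.ofReal_ne_zero_iff]
    positivity

theorem norm_exp_char (u x : ℝ) :
    ‖Complex.exp ((-2) * (Real.pi : ℂ) * Complex.I * (u : ℂ) * (x : ℂ))‖ = 1 := by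
  rw [show (-2) * (Real.pi : ℂ) * Complex.I * (u : ℂ) * (x : ℂ) =
    ((-2 * Real.pi * u * x : ℝ) : ℂ) * Complex.I by push_cast; ring]
  exact Complex.norm_exp_ofReal_mul_I _

/-- Convergence of integrals of bounded continuous real functions implies pointwise convergence of
the Fourier–Stieltjes transforms. -/
theorem tendsto_ftransform {ν : ℕ → Measure ℝ} {μ : Measure ℝ} [IsProbabilityMeasure μ]
    (hweak : ∀ f : BoundedContinuousFunction ℝ ℝ,
      Tendsto (fun k : ℕ => ∫ x, f x ∂(ν k)) atTop (nhds (∫ x, f x ∂μ))) (u : ℝ)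
    (hν : ∀ k, Integrable (fun x : ℝ =>
      Complex.exp ((-2) * (Real.pi : ℂ) * Complex.I * (u : ℂ) * (x : ℂ))) (ν k)) :
    Tendsto (fun k => ftransform (ν k) u) atTop (nhds (ftransform μ u)) := by
  have hμ : Integrable (fun x : ℝ =>
      Complex.exp ((-2) * (Real.pi : ℂ) * Complex.I * (u : ℂ) * (x : ℂ))) μ :=
    Integrable.of_bound (continuous_exp_char u).aestronglyMeasurable 1
      (Eventually.of_forall fun x => (norm_exp_char u x).le)
  have hre := hweak (BoundedContinuousFunction.ofNormedAddCommGroup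
    (fun x : ℝ => (Complex.exp ((-2) * (Real.pi : ℂ) * Complex.I * (u : ℂ) * (x : ℂ))).re)
    (Complex.continuous_re.comp (continuous_exp_char u)) 1
    fun x => (Complex.abs_re_le_norm _).trans (norm_exp_char u x).le)
  have him := hweak (BoundedContinuousFunction.ofNormedAddCommGroup
    (fun x : ℝ => (Complex.exp ((-2) * (Real.pi : ℂ) * Complex.I * (u : ℂ) * (x : ℂ))).im)
    (Complex.continuous_im.comp (continuous_exp_char u)) 1
    fun x => (Complex.abs_im_le_norm _).trans (norm_exp_char u x).le)
  have key : ∀ ρ : Measure ℝ, Integrable (fun x : ℝ =>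
      Complex.exp ((-2) * (Real.pi : ℂ) * Complex.I * (u : ℂ) * (x : ℂ))) ρ →
      ftransform ρ u =
        ((∫ x : ℝ, (Complex.exp ((-2) * (Real.pi : ℂ) * Complex.I * (u : ℂ) * (x : ℂ))).re ∂ρ : ℝ)
          : ℂ) +
        ((∫ x : ℝ, (Complex.exp ((-2) * (Real.pi : ℂ) * Complex.I * (u : ℂ) * (x : ℂ))).im ∂ρ : ℝ)
          : ℂ) * Complex.I := fun ρ hρ => (integral_re_add_im hρ).symm
  rw [key μ hμ]
  simp only [fun k => key (ν k) (hν k)]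
  exact ((Complex.continuous_ofReal.tendsto _).comp hre).add
    (((Complex.continuous_ofReal.tendsto _).comp him).mul_const _)

theorem tendsto_average_exp (u : ℝ) {L : ℕ → ℝ} (hpos : ∀ k, 0 < L k)
    (hL : Tendsto L atTop (nhds 0)) :
    Tendsto (fun k => (L k)⁻¹ • ∫ t in (0 : ℝ)..L k,
      Complex.exp ((-2) * (Real.pi : ℂ) * Complex.I * (u : ℂ) * (t : ℂ))) atTop (nhds 1) := by
  have hd := ((continuous_exp_char u).integral_hasStrictDerivAt 0 0).hasDerivAt
  rw [hasDerivAt_iff_tendsto_slope_zero] at hd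
  simpa [Function.comp_def] using hd.comp (tendsto_nhdsWithin_iff.2
    ⟨hL, Eventually.of_forall fun k => (hpos k).ne'⟩)

/-- Product representation of the Fourier–Stieltjes transform of the limit measure:
with the construction above, for every `u ∈ ℝ`,
`μ̂(u) = lim_{m→∞} Q^{(1)}(u) ∏_{k=1}^{m} Q^{(k+1)}(η_1⋯η_k · u)`. -/
theorem statement14 (A : Set ℕ) (β : ℝ) (hβ0 : 0 < β) (hβ1 : β ≤ 1)
    (hdens : HasUpperFracDensity A β)
    (N : ℕ → ℕ) (hN : StrictMono N) (hNpos : 0 < N 1)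
    (c C : ℝ) (hc : 0 < c)
    (hbound : ∀ i : ℕ, 1 ≤ i →
      c ≤ (cardBelow A (N i) : ℝ) / (N i : ℝ) ^ β ∧
      (cardBelow A (N i) : ℝ) / (N i : ℝ) ^ β ≤ C)
    (μ : MeasureTheory.Measure ℝ) (hμ : MeasureTheory.IsProbabilityMeasure μ)
    (hsupp : μ (Blim A N)ᶜ = 0)
    (hweak : ∀ f : BoundedContinuousFunction ℝ ℝ,
      Filter.Tendsto (fun k : ℕ => ∫ x, f x ∂(muk A N k)) Filter.atTop
        (nhds (∫ x, f x ∂μ))) :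
    ∀ u : ℝ,
      Filter.Tendsto
        (fun m : ℕ =>
          Qsum A N 1 u * ∏ k ∈ Finset.Icc 1 m, Qsum A N (k + 1) (etaProd k * u))
        Filter.atTop (nhds (ftransform μ u)) := by
  intro u
  have hpos : ∀ k, 0 < N (k + 1) := fun k => k.succ_pos.trans_le (hN.id_le _)
  have hA : ∀ k, 0 < cardBelow A (N (k + 1)) := by
    intro k
    by_contra h
    have h0 : cardBelow A (N (k + 1)) = 0 := by omega
    have h1 := (hbound (k + 1) (by omega)).1
    rw [h0, Nat.cast_zero, zero_div] at h1
    exact h1.not_gt hc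
  have hF := tendsto_ftransform hweak u fun k => integrable_exp_muk hpos hA k u
  have hS := tendsto_average_exp u (Lfun_pos hpos) (tendsto_Lfun hN)
  have hP : Tendsto (fun k => ∏ j ∈ Finset.range k, Qsum A N (j + 1) (etaProd j * u)) atTop
      (nhds (ftransform μ u)) := by
    have h := hF.div hS one_ne_zero
    rw [div_one] at h
    refine h.congr' ?_
    filter_upwards [hS.eventually_ne one_ne_zero] with k hk
    rw [Pi.div_apply, ftransform_muk hpos, mul_div_cancel_right₀ _ hk]
  rw [← tendsto_add_atTop_iff_nat 1] at hP
  refine hP.congr fun m => ?_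
  rw [Finset.prod_range_succ', mul_comm, ← Finset.Ico_add_one_right_eq_Icc,
    Finset.prod_Ico_eq_prod_range]
  simp [etaProd, add_comm 1]
end
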